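/- arXiv:1110.1960 — 3 statements merged into one kernel-verified Lean document; each statement's English description precedes it below -/
import Mathlib

section
/- Assume c ∈ O_K is such that v(c) = a/b, where a and b are positive integers both prime to p, and 0 < a/b < p/((q+1)(p−1)). Then the polynomial L_c(X) is irreducible over K. -/
open Polynomial

noncomputable section

/-- `K₀`: the fraction field of the Witt vectors over `𝔽̄_p`, i.e. the completion of `ℚ_p^ur`. -/
abbrev Kzero (p : ℕ) [Fact p.Prime] : Type :=
  FractionRing (WittVector p (AlgebraicClosure (ZMod p)))

/-- `Ω`: a fixed algebraic closure of `K₀`. -/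
abbrev Omg (p : ℕ) [Fact p.Prime] : Type := AlgebraicClosure (Kzero p)

/-- `a_n = (-1)^q · (-p)^(p + p² + ⋯ + pⁿ)` as an element of a commutative ring. -/
def aCoef (R : Type) [CommRing R] (p n : ℕ) : R :=
  (-1) ^ p ^ n * (-(p : R)) ^ (Finset.sum (Finset.range n) fun i => p ^ (i + 1))

/-- `f_{q,c}(X) = 1 + c·X^q + X^(1+q)` with `q = pⁿ`. -/
def fqc (R : Type) [CommRing R] (p n : ℕ) (c : R) : Polynomial R :=
  1 + C c * X ^ p ^ n + X ^ (p ^ n + 1)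

/-- The modified monodromy polynomial `L_c(X) = X^(q²) − a_n·(c+X)·f_{q,c}(X)^(q−1)`. -/
def Lpoly (R : Type) [CommRing R] (p n : ℕ) (c : R) : Polynomial R :=
  X ^ (p ^ n * p ^ n) - C (aCoef R p n) * (C c + X) * fqc R p n c ^ (p ^ n - 1)

set_option maxHeartbeats 1000000

/-- A rational-valued additive valuation, described by its values on nonzero elements. -/
structure IsRatValuation {F : Type*} [Field F] (v : F → ℚ) : Prop where
  map_mul : ∀ x y : F, x ≠ 0 → y ≠ 0 → v (x * y) = v x + v y
  map_add : ∀ x y : F, x ≠ 0 → y ≠ 0 → x + y ≠ 0 → min (v x) (v y) ≤ v (x + y)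

namespace IsRatValuation

variable {F : Type*} [Field F] {v : F → ℚ}

lemma map_one (h : IsRatValuation v) : v 1 = 0 := by
  have := h.map_mul 1 1 one_ne_zero one_ne_zero
  rw [mul_one] at this
  linarith

lemma map_neg_one (h : IsRatValuation v) : v (-1) = 0 := by
  have := h.map_mul (-1) (-1) (neg_ne_zero.2 one_ne_zero) (neg_ne_zero.2 one_ne_zero)
  rw [neg_one_mul, neg_neg, h.map_one] at this
  linarith

lemma map_neg (h : IsRatValuation v) (x : F) : v (-x) = v x := by
  rcases eq_or_ne x 0 with rfl | hx
  · rw [neg_zero]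
  · rw [← neg_one_mul, h.map_mul _ _ (neg_ne_zero.2 one_ne_zero) hx, h.map_neg_one, zero_add]

lemma map_inv (h : IsRatValuation v) {x : F} (hx : x ≠ 0) : v x⁻¹ = -v x := by
  have := h.map_mul x x⁻¹ hx (inv_ne_zero hx)
  rw [mul_inv_cancel₀ hx, h.map_one] at this
  linarith

lemma map_div (h : IsRatValuation v) {x y : F} (hx : x ≠ 0) (hy : y ≠ 0) :
    v (x / y) = v x - v y := by
  rw [div_eq_mul_inv, h.map_mul _ _ hx (inv_ne_zero hy), h.map_inv hy, sub_eq_add_neg]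

lemma map_pow (h : IsRatValuation v) {x : F} (hx : x ≠ 0) (m : ℕ) : v (x ^ m) = m * v x := by
  induction m with
  | zero => simp [h.map_one]
  | succ m ih =>
    rw [pow_succ, h.map_mul _ _ (pow_ne_zero _ hx) hx, ih]
    push_cast
    ring

lemma map_add_of_lt (h : IsRatValuation v) {x y : F} (hx : x ≠ 0) (hy : y ≠ 0)
    (hlt : v x < v y) : x + y ≠ 0 ∧ v (x + y) = v x := by
  have hne : x + y ≠ 0 := by
    intro h0
    rw [eq_neg_of_add_eq_zero_left h0, h.map_neg] at hlt
    exact lt_irrefl _ hlt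
  refine ⟨hne, ?_⟩
  have h1 := h.map_add x y hx hy hne
  have h2 := h.map_add (x + y) (-y) hne (neg_ne_zero.2 hy) (by simpa using hx)
  rw [h.map_neg, add_neg_cancel_right] at h2
  rw [min_eq_left hlt.le] at h1
  rcases min_le_iff.1 h2 with h3 | h3
  · exact le_antisymm h3 h1
  · exact absurd h3 (not_le.2 hlt)

lemma map_sum_of_injOn (h : IsRatValuation v) {ι : Type*} (s : Finset ι) (t : ι → F)
    (ht : ∀ i ∈ s, t i ≠ 0) (hinj : Set.InjOn (fun i => v (t i)) s) (hs : s.Nonempty) :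
    ∑ i ∈ s, t i ≠ 0 ∧ ∃ i ∈ s, v (∑ i ∈ s, t i) = v (t i) := by
  induction hs using Finset.Nonempty.cons_induction with
  | singleton a => simpa using ht a (by simp)
  | cons a s ha hs ih =>
    obtain ⟨h0, i, hi, hvi⟩ := ih (fun i hi => ht i (by simp [hi]))
      (hinj.mono (by simp))
    have hta := ht a (by simp)
    have hne : v (t a) ≠ v (∑ i ∈ s, t i) := by
      rw [hvi]
      intro heq
      have := hinj (by simp) (by simp [hi]) heq
      exact ha (this ▸ hi)
    rw [Finset.sum_cons]
    rcases lt_or_gt_of_ne hne with hlt | hlt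
    · obtain ⟨h1, h2⟩ := h.map_add_of_lt hta h0 hlt
      exact ⟨h1, a, by simp, h2⟩
    · obtain ⟨h1, h2⟩ := h.map_add_of_lt h0 hta hlt
      rw [add_comm]
      exact ⟨h1, i, by simp [hi], h2.trans hvi⟩

lemma map_prod_of_forall_eq (h : IsRatValuation v) {s : ℚ} (m : Multiset F)
    (hm : ∀ x ∈ m, x ≠ 0 ∧ v x = s) : m.prod ≠ 0 ∧ v m.prod = m.card * s := by
  induction m using Multiset.induction with
  | empty => simp [h.map_one]
  | cons a m ih =>
    obtain ⟨h0, h1⟩ := ih fun x hx => hm x (Multiset.mem_cons_of_mem hx)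
    obtain ⟨h2, h3⟩ := hm a (Multiset.mem_cons_self a m)
    rw [Multiset.prod_cons, h.map_mul _ _ h2 h0, h1, h3, Multiset.card_cons]
    refine ⟨mul_ne_zero h2 h0, ?_⟩
    push_cast
    ring

/-- The valuation ring. -/
def integers (h : IsRatValuation v) : Subring F where
  carrier := {x | x = 0 ∨ 0 ≤ v x}
  zero_mem' := Or.inl rfl
  one_mem' := Or.inr h.map_one.ge
  mul_mem' := by
    intro x y hx hy
    by_cases hx0 : x = 0
    · left; simp [hx0]
    by_cases hy0 : y = 0
    · left; simp [hy0]
    right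
    rw [h.map_mul x y hx0 hy0]
    exact add_nonneg (hx.resolve_left hx0) (hy.resolve_left hy0)
  add_mem' := by
    intro x y hx hy
    by_cases hx0 : x = 0
    · simpa [hx0] using hy
    by_cases hy0 : y = 0
    · simpa [hy0] using hx
    by_cases hxy : x + y = 0
    · exact Or.inl hxy
    right
    exact (le_min (hx.resolve_left hx0) (hy.resolve_left hy0)).trans (h.map_add x y hx0 hy0 hxy)
  neg_mem' := by
    intro x hx
    rcases hx with hx | hx
    · left; simp [hx]
    · right; rwa [h.map_neg]

lemma nonneg_of_mem_integers (h : IsRatValuation v) {x : F} (hx : x ∈ h.integers) (h0 : x ≠ 0) :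
    0 ≤ v x :=
  Or.resolve_left hx h0

lemma map_primitiveRoot (h : IsRatValuation v) {ζ : F} {k : ℕ} (hk : 0 < k)
    (hζ : IsPrimitiveRoot ζ k) : v ζ = 0 := by
  have := h.map_pow (hζ.ne_zero hk.ne') k
  rw [hζ.pow_eq_one, h.map_one] at this
  have hk' : (k : ℚ) ≠ 0 := by exact_mod_cast hk.ne'
  simpa [hk'] using this.symm

lemma map_sub_one_le_map_pow_sub_one (h : IsRatValuation v) {ζ : F} {k : ℕ} (hk : 0 < k)
    (hζ : IsPrimitiveRoot ζ k) (j : ℕ) (hj : ζ ^ j - 1 ≠ 0) : v (ζ - 1) ≤ v (ζ ^ j - 1) := by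
  have hmem : ∑ i ∈ Finset.range j, ζ ^ i ∈ h.integers :=
    sum_mem fun i _ => pow_mem (Or.inr (h.map_primitiveRoot hk hζ).ge) i
  rw [← geom_sum_mul] at hj ⊢
  rw [h.map_mul _ _ (left_ne_zero_of_mul hj) (right_ne_zero_of_mul hj)]
  have := h.nonneg_of_mem_integers hmem (left_ne_zero_of_mul hj)
  linarith

lemma map_pow_sub_one (h : IsRatValuation v) {p : ℕ} (hp : p.Prime) {ζ : F}
    (hζ : IsPrimitiveRoot ζ p) {j : ℕ} (hj0 : 0 < j) (hj : j < p) :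
    ζ ^ j - 1 ≠ 0 ∧ v (ζ ^ j - 1) = v (ζ - 1) := by
  have hcop : j.Coprime p := (Nat.coprime_of_lt_prime hj0.ne' hj hp).symm
  have hζj : IsPrimitiveRoot (ζ ^ j) p := hζ.pow_of_coprime j hcop
  have h1 : ζ - 1 ≠ 0 := sub_ne_zero.2 (hζ.ne_one hp.one_lt)
  have h2 : ζ ^ j - 1 ≠ 0 := sub_ne_zero.2 (hζj.ne_one hp.one_lt)
  refine ⟨h2, le_antisymm ?_ (h.map_sub_one_le_map_pow_sub_one hp.pos hζ j h2)⟩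
  have : NeZero p := ⟨hp.ne_zero⟩
  obtain ⟨i, -, hi⟩ := hζj.eq_pow_of_pow_eq_one hζ.pow_eq_one
  have := h.map_sub_one_le_map_pow_sub_one hp.pos hζj i (by rwa [hi])
  rwa [hi] at this

lemma sub_one_mul_map_sub_one (h : IsRatValuation v) {p : ℕ} (hp : p.Prime) (hvp : v (p : F) = 1)
    {ζ : F} (hζ : IsPrimitiveRoot ζ p) : ((p : ℚ) - 1) * v (ζ - 1) = 1 := by
  obtain ⟨m, rfl⟩ : ∃ m, p = m + 1 := ⟨p - 1, by have := hp.pos; omega⟩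
  have hprod := hζ.prod_one_sub_pow_eq_order
  have hm := h.map_prod_of_forall_eq (s := v (ζ - 1))
    ((Finset.range m).val.map fun k => 1 - ζ ^ (k + 1)) (by
      intro x hx
      obtain ⟨k, hk, rfl⟩ := Multiset.mem_map.1 hx
      have hk' : k < m := by simpa using hk
      obtain ⟨h1, h2⟩ := h.map_pow_sub_one hp hζ k.succ_pos (by omega)
      rw [← neg_sub, neg_ne_zero, h.map_neg]
      exact ⟨h1, h2⟩)
  have hm2 := hm.2
  rw [← Finset.prod_eq_multiset_prod, hprod] at hm2
  push_cast at hvp hm2 ⊢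
  rw [hvp] at hm2
  simp at hm2
  linarith

/-- If `v` is integral on a subfield `k` and `v μ = 1 / e` with `μ` killed by a nonzero
polynomial of degree at most `e`, then `e • v` is integral on `k(μ)`. -/
lemma exists_int_of_mem_adjoin (h : IsRatValuation v) {k : Type*} [Field k] [Algebra k F]
    (hk : ∀ x : k, x ≠ 0 → ∃ m : ℤ, v (algebraMap k F x) = m) {e : ℕ} {μ : F}
    (hμ0 : μ ≠ 0) (hμ : (e : ℚ) * v μ = 1) {g : k[X]} (hg0 : g ≠ 0) (hge : g.natDegree ≤ e)
    (hg : aeval μ g = 0) (x : IntermediateField.adjoin k {μ}) (hx : (x : F) ≠ 0) :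
    ∃ m : ℤ, (e : ℚ) * v (x : F) = m := by
  have hint : IsIntegral k μ := isAlgebraic_iff_isIntegral.1 ⟨g, hg0, hg⟩
  obtain ⟨P, hPdeg, hPx⟩ := (IntermediateField.adjoin.powerBasis hint).exists_eq_aeval x
  rw [IntermediateField.adjoin.powerBasis_dim] at hPdeg
  have hdeg : P.natDegree < e :=
    hPdeg.trans_le ((natDegree_le_of_dvd (minpoly.dvd k μ hg) hg0).trans hge)
  have hxP : (x : F) = ∑ i ∈ P.support, algebraMap k F (P.coeff i) * μ ^ i := by
    rw [hPx, IntermediateField.adjoin.powerBasis_gen, ← IntermediateField.aeval_coe,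
      IntermediateField.AdjoinSimple.coe_gen, aeval_def, eval₂_eq_sum, Polynomial.sum]
  have hP0 : P.support.Nonempty := by
    rw [Finset.nonempty_iff_ne_empty]
    intro h0
    rw [h0, Finset.sum_empty] at hxP
    exact hx hxP
  have hc0 : ∀ i ∈ P.support, algebraMap k F (P.coeff i) ≠ 0 := fun i hi => by
    simpa using hi
  have hterm : ∀ i ∈ P.support, ∃ m : ℤ,
      (e : ℚ) * v (algebraMap k F (P.coeff i) * μ ^ i) = ((m * e + i : ℤ) : ℚ) := by
    intro i hi
    obtain ⟨m, hm⟩ := hk (P.coeff i) (mem_support_iff.1 hi)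
    refine ⟨m, ?_⟩
    rw [h.map_mul _ _ (hc0 i hi) (pow_ne_zero _ hμ0), h.map_pow hμ0, hm]
    push_cast
    linear_combination (i : ℚ) * hμ
  obtain ⟨-, i, hi, hvi⟩ := h.map_sum_of_injOn P.support
    (fun i => algebraMap k F (P.coeff i) * μ ^ i)
    (fun i hi => mul_ne_zero (hc0 i hi) (pow_ne_zero _ hμ0)) (by
      intro i hi j hj hij
      obtain ⟨m, hm⟩ := hterm i hi
      obtain ⟨m', hm'⟩ := hterm j hj
      simp only at hij
      rw [hij, hm'] at hm
      have hm2 : m' * e + j = m * e + i := by exact_mod_cast hm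
      have hil : i < e := (le_natDegree_of_mem_supp i hi).trans_lt hdeg
      have hjl : j < e := (le_natDegree_of_mem_supp j hj).trans_lt hdeg
      have := congrArg (· % (e : ℤ)) hm2
      simp only [add_comm (_ * (e : ℤ)), Int.add_mul_emod_self_right] at this
      rw [Int.emod_eq_of_lt (by omega) (by omega), Int.emod_eq_of_lt (by omega) (by omega)] at this
      omega) hP0
  obtain ⟨m, hm⟩ := hterm i hi
  exact ⟨m * e + i, by rw [hxP, hvi, hm]⟩

/-- Newton polygon of `L_c`: all the roots have the same valuation. -/
lemma map_root (h : IsRatValuation v) {q : ℕ} (hq : 2 ≤ q) {A c y : F} (hA0 : A ≠ 0)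
    (hc0 : c ≠ 0) (hA : 0 < v A) (hc : 0 < v c) (hlt : ((q : ℚ) ^ 2 - 1) * v c < v A)
    (hy : y ^ (q * q) = A * (c + y) * (1 + c * y ^ q + y ^ (q + 1)) ^ (q - 1)) :
    y ≠ 0 ∧ v y = (v A + v c) / (q : ℚ) ^ 2 := by
  have hq' : (2 : ℚ) ≤ q := by exact_mod_cast hq
  have hy0 : y ≠ 0 := by
    rintro rfl
    have h1 : q ≠ 0 := by omega
    simp [h1, hA0, hc0] at hy
  have hne := pow_ne_zero (q * q) hy0
  have hf : (1 + c * y ^ q + y ^ (q + 1)) = 1 + y ^ q * (c + y) := by ring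
  rw [hf] at hy
  rw [hy] at hne
  have hcy : c + y ≠ 0 := right_ne_zero_of_mul (left_ne_zero_of_mul hne)
  have hf0 : 1 + y ^ q * (c + y) ≠ 0 := by
    intro h0
    rw [h0, zero_pow (by omega), mul_zero] at hne
    exact hne rfl
  have hz0 : y ^ q * (c + y) ≠ 0 := mul_ne_zero (pow_ne_zero _ hy0) hcy
  have hvz : v (y ^ q * (c + y)) = q * v y + v (c + y) := by
    rw [h.map_mul _ _ (pow_ne_zero _ hy0) hcy, h.map_pow hy0]
  have hmain : (q : ℚ) ^ 2 * v y
      = v A + v (c + y) + ((q : ℚ) - 1) * v (1 + y ^ q * (c + y)) := by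
    have := congrArg v hy
    rw [h.map_pow hy0, h.map_mul _ _ (mul_ne_zero hA0 hcy) (pow_ne_zero _ hf0),
      h.map_mul _ _ hA0 hcy, h.map_pow hf0, Nat.cast_sub (by omega)] at this
    push_cast at this
    linarith
  have hadd := h.map_add c y hc0 hy0 hcy
  have hnonneg : 0 ≤ v y := by
    by_contra! hneg
    have h1 : v (c + y) = v y := by
      rw [add_comm]
      exact (h.map_add_of_lt hy0 hc0 (by linarith)).2
    have hneg2 : v (y ^ q * (c + y)) < 0 := by
      rw [hvz, h1]
      nlinarith
    have h2 := (h.map_add_of_lt hz0 one_ne_zero (by rwa [h.map_one])).2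
    rw [add_comm 1, h2, hvz, h1] at hmain
    nlinarith
  have hcy_nonneg : 0 ≤ v (c + y) := (le_min hc.le hnonneg).trans hadd
  have hf_nonneg : 0 ≤ v (1 + y ^ q * (c + y)) := by
    have := h.map_add 1 (y ^ q * (c + y)) one_ne_zero hz0 hf0
    refine (le_min ?_ ?_).trans this
    · rw [h.map_one]
    · rw [hvz]
      positivity
  have hpos : 0 < v y := by
    by_contra! hle
    have h0 : v y = 0 := le_antisymm hle hnonneg
    rw [h0] at hmain
    have : 0 ≤ ((q : ℚ) - 1) * v (1 + y ^ q * (c + y)) :=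
      mul_nonneg (by linarith) hf_nonneg
    linarith
  have hf1 : v (1 + y ^ q * (c + y)) = 0 := by
    rw [(h.map_add_of_lt one_ne_zero hz0 ?_).2, h.map_one]
    rw [h.map_one, hvz]
    positivity
  rw [hf1, mul_zero, add_zero] at hmain
  have hgt : v c < v y := by
    by_contra! hle
    rw [min_eq_right hle] at hadd
    have h1 : 0 ≤ (q : ℚ) ^ 2 - 1 := by nlinarith
    nlinarith [mul_le_mul_of_nonneg_left hle h1]
  rw [(h.map_add_of_lt hc0 hy0 hgt).2] at hmain
  refine ⟨hy0, ?_⟩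
  rw [eq_div_iff (by positivity)]
  linarith

/-- If every root of `g` has valuation `s`, then `(deg g) * s` is a difference of valuations of
coefficients of `g`. -/
lemma natDegree_mul_eq (h : IsRatValuation v) [IsAlgClosed F] {g : F[X]} (hg : g ≠ 0) {s : ℚ}
    (hroots : ∀ y, g.IsRoot y → y ≠ 0 ∧ v y = s) :
    g.coeff 0 ≠ 0 ∧ g.natDegree * s = v (g.coeff 0) - v g.leadingCoeff := by
  have hsp : g.Splits := IsAlgClosed.splits g
  have hl : g.leadingCoeff ≠ 0 := leadingCoeff_ne_zero.2 hg
  have hm := h.map_prod_of_forall_eq g.roots fun y hy => hroots y (isRoot_of_mem_roots hy)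
  have h1 : g.coeff 0 = (-1) ^ g.natDegree * (g.leadingCoeff * g.roots.prod) := by
    rw [hsp.coeff_zero_eq_leadingCoeff_mul_prod_roots]
    ring
  have hs : (-1 : F) ^ g.natDegree ≠ 0 := pow_ne_zero _ (neg_ne_zero.2 one_ne_zero)
  refine ⟨h1 ▸ mul_ne_zero hs (mul_ne_zero hl hm.1), ?_⟩
  rw [h1, h.map_mul _ _ hs (mul_ne_zero hl hm.1), h.map_mul _ _ hl hm.1, hm.2,
    h.map_pow (neg_ne_zero.2 one_ne_zero), h.map_neg_one, ← hsp.natDegree_eq_card_roots]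
  ring

end IsRatValuation

lemma exists_int_of_wittVector {p : ℕ} [Fact p.Prime] {k : Type*} [Field k] [CharP k p]
    [PerfectRing k p] {F : Type*} [Field F] [Algebra (FractionRing (WittVector p k)) F] {v : F → ℚ}
    (h : IsRatValuation v) (hvp : v (p : F) = 1)
    (hW : ∀ x : WittVector p k, x ≠ 0 → 0 ≤ v (algebraMap (FractionRing (WittVector p k)) F
      (algebraMap (WittVector p k) (FractionRing (WittVector p k)) x)))
    (x : FractionRing (WittVector p k)) (hx : x ≠ 0) :
    ∃ m : ℤ, v (algebraMap (FractionRing (WittVector p k)) F x) = m := by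
  set φ : WittVector p k →+* F := (algebraMap (FractionRing (WittVector p k)) F).comp
    (algebraMap (WittVector p k) (FractionRing (WittVector p k)))
  have hφ : Function.Injective φ :=
    (algebraMap (FractionRing (WittVector p k)) F).injective.comp
      (IsFractionRing.injective (WittVector p k) (FractionRing (WittVector p k)))
  have hφ0 : ∀ z : WittVector p k, z ≠ 0 → φ z ≠ 0 := fun z hz =>
    (map_ne_zero_iff φ hφ).2 hz
  have hp0 : (p : F) ≠ 0 := by
    have := hφ0 (p : WittVector p k) (WittVector.p_nonzero p k)
    rwa [map_natCast] at this
  have hint : ∀ z : WittVector p k, z ≠ 0 → ∃ m : ℕ, v (φ z) = m := by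
    intro z hz
    obtain ⟨m, u, hu⟩ := WittVector.exists_eq_pow_p_mul' z hz
    refine ⟨m, ?_⟩
    have hu0 : v (φ u) = 0 := by
      have h1 : 0 ≤ v (φ u) := hW u u.ne_zero
      have h2 : 0 ≤ v (φ (u⁻¹ : (WittVector p k)ˣ)) := hW _ (u⁻¹).ne_zero
      have h3 := h.map_mul (φ u) (φ (u⁻¹ : (WittVector p k)ˣ)) (hφ0 _ u.ne_zero)
        (hφ0 _ (u⁻¹).ne_zero)
      rw [← map_mul, Units.mul_inv, map_one, h.map_one] at h3
      linarith
    rw [hu, map_mul, map_pow, map_natCast, h.map_mul _ _ (pow_ne_zero _ hp0) (hφ0 _ u.ne_zero),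
      h.map_pow hp0, hvp, hu0]
    ring
  obtain ⟨r, s, hs, rfl⟩ := IsFractionRing.div_surjective (A := WittVector p k) x
  have hs0 : s ≠ 0 := nonZeroDivisors.ne_zero hs
  have hr0 : r ≠ 0 := by
    rintro rfl
    simp at hx
  obtain ⟨m, hm⟩ := hint r hr0
  obtain ⟨m', hm'⟩ := hint s hs0
  refine ⟨m - m', ?_⟩
  rw [map_div₀]
  change v (φ r / φ s) = _
  rw [h.map_div (hφ0 _ hr0) (hφ0 _ hs0), hm, hm']
  push_cast
  rfl

lemma aCoef_map {R S : Type} [CommRing R] [CommRing S] (φ : R →+* S) (p n : ℕ) :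
    φ (aCoef R p n) = aCoef S p n := by
  simp [aCoef]

lemma aeval_Lpoly {R S : Type} [CommRing R] [CommRing S] [Algebra R S] (p n : ℕ) (c : R) (y : S) :
    aeval y (Lpoly R p n c) = y ^ (p ^ n * p ^ n) - aCoef S p n * (algebraMap R S c + y)
      * (1 + algebraMap R S c * y ^ p ^ n + y ^ (p ^ n + 1)) ^ (p ^ n - 1) := by
  simp only [Lpoly, fqc, map_sub, map_mul, map_pow, map_add, map_one, aeval_X, aeval_C]
  rw [aCoef_map]

lemma natDegree_fqc_le {R : Type} [CommRing R] (p n : ℕ) (c : R) :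
    (fqc R p n c).natDegree ≤ p ^ n + 1 := by
  unfold fqc
  compute_degree!

lemma coeff_fqc {R : Type} [CommRing R] (p n : ℕ) (c : R) :
    (fqc R p n c).coeff (p ^ n + 1) = 1 := by
  simp [fqc, coeff_one]

lemma natDegree_Lpoly_aux {R : Type} [CommRing R] (p n : ℕ) [Fact p.Prime] (c : R) :
    ((C c + X) * fqc R p n c ^ (p ^ n - 1)).natDegree ≤ p ^ n * p ^ n ∧
      ((C c + X) * fqc R p n c ^ (p ^ n - 1)).coeff (p ^ n * p ^ n) = 1 := by
  have hq : 0 < p ^ n := pow_pos (Fact.out : p.Prime).pos n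
  have hdeg : p ^ n * p ^ n = 1 + (p ^ n - 1) * (p ^ n + 1) := by
    obtain ⟨m, hm⟩ : ∃ m, p ^ n = m + 1 := ⟨p ^ n - 1, by omega⟩
    rw [hm, Nat.add_sub_cancel]
    ring
  have h1 : (C c + X : R[X]).natDegree ≤ 1 := by compute_degree
  have h2 := natDegree_pow_le_of_le (p ^ n - 1) (natDegree_fqc_le p n c)
  rw [hdeg]
  refine ⟨natDegree_mul_le_of_le h1 h2, ?_⟩
  rw [coeff_mul_add_eq_of_natDegree_le h1 h2, coeff_pow_of_natDegree_le (natDegree_fqc_le p n c),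
    coeff_fqc]
  simp

lemma natDegree_Lpoly_le {R : Type} [CommRing R] (p n : ℕ) [Fact p.Prime] (c : R) :
    (Lpoly R p n c).natDegree ≤ p ^ n * p ^ n := by
  unfold Lpoly
  rw [mul_assoc]
  exact (natDegree_sub_le_of_le (natDegree_X_pow_le _)
    ((natDegree_C_mul_le _ _).trans (natDegree_Lpoly_aux p n c).1)).trans (max_self _).le

lemma coeff_Lpoly {R : Type} [CommRing R] (p n : ℕ) [Fact p.Prime] (c : R) :
    (Lpoly R p n c).coeff (p ^ n * p ^ n) = 1 - aCoef R p n := by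
  unfold Lpoly
  rw [mul_assoc, coeff_sub, coeff_C_mul, (natDegree_Lpoly_aux p n c).2, coeff_X_pow_self, mul_one]

lemma sub_one_mul_sum_pow (p n : ℕ) :
    ((p : ℚ) - 1) * ((∑ i ∈ Finset.range n, p ^ (i + 1) : ℕ) : ℚ) = p * ((p : ℚ) ^ n - 1) := by
  rw [← mul_geom_sum]
  push_cast
  simp only [pow_succ, Finset.mul_sum]
  refine Finset.sum_congr rfl fun i _ => ?_
  ring

lemma sq_dvd_of_slope {p n a b e d N : ℕ} [Fact p.Prime] (hb : 0 < b) (hap : a.Coprime p)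
    (hep : e.Coprime p) (hN : p ∣ N) {t : ℤ}
    (h : (e : ℚ) * (d * ((N + (a : ℚ) / b) / ((p ^ n : ℕ) : ℚ) ^ 2)) = t) :
    p ^ n * p ^ n ∣ d := by
  have hb' : (b : ℚ) ≠ 0 := by exact_mod_cast hb.ne'
  have hq' : ((p ^ n : ℕ) : ℚ) ≠ 0 := by
    exact_mod_cast pow_ne_zero n (Fact.out : p.Prime).ne_zero
  have h1 : ((d * (e * (N * b + a)) : ℕ) : ℤ) = ((p ^ n * p ^ n : ℕ) : ℤ) * (b * t) := by
    have : ((d * (e * (N * b + a)) : ℕ) : ℚ) = ((p ^ n * p ^ n : ℕ) : ℚ) * (b * t) := by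
      rw [← h, Nat.cast_mul (p ^ n)]
      field_simp
      push_cast
      ring
    exact_mod_cast this
  have h2 : p ^ n * p ^ n ∣ d * (e * (N * b + a)) :=
    Int.natCast_dvd_natCast.1 ⟨_, h1⟩
  refine Nat.Coprime.dvd_of_dvd_mul_right ?_ h2
  have h3 : (N * b + a).Coprime p := by
    obtain ⟨m, rfl⟩ := hN
    rw [mul_assoc, add_comm, Nat.coprime_add_mul_left_left]
    exact hap
  rw [← pow_add]
  exact Nat.Coprime.pow_left _ (hep.mul_left h3).symm

/-- if `c ∈ O_K` has `v(c) = a/b` with `a, b` positive integers prime to `p` and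
`0 < a/b < p/((q+1)(p−1))`, then `L_c` is irreducible over `K = K₀(μ)`. -/
theorem stmt_10 (p n : ℕ) [Fact p.Prime] (hn : 1 ≤ n)
    (v : Omg p → ℚ)
    (hv_mul : ∀ x y : Omg p, x ≠ 0 → y ≠ 0 → v (x * y) = v x + v y)
    (hv_add : ∀ x y : Omg p, x ≠ 0 → y ≠ 0 → x + y ≠ 0 → min (v x) (v y) ≤ v (x + y))
    (hv_p : v ((p : ℕ) : Omg p) = 1)
    (hv_W : ∀ x : WittVector p (AlgebraicClosure (ZMod p)), x ≠ 0 →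
      0 ≤ v (algebraMap (Kzero p) (Omg p)
        (algebraMap (WittVector p (AlgebraicClosure (ZMod p))) (Kzero p) x)))
    (ζ : Omg p) (hζ : IsPrimitiveRoot ζ p)
    (μ : Omg p) (hμ : μ ^ (p ^ n + 1) = ζ - 1)
    (c : ↥(IntermediateField.adjoin (Kzero p) {μ})) (hc0 : (c : Omg p) ≠ 0)
    (a b : ℕ) (ha : 0 < a) (hb : 0 < b) (hap : a.Coprime p) (hbp : b.Coprime p)
    (hvc : v (c : Omg p) = (a : ℚ) / (b : ℚ))
    (hc_lt : (a : ℚ) / (b : ℚ) < (p : ℚ) / (((p : ℚ) ^ n + 1) * ((p : ℚ) - 1))) :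
    Irreducible (Lpoly ↥(IntermediateField.adjoin (Kzero p) {μ}) p n c) := by
  have h : IsRatValuation v := ⟨hv_mul, hv_add⟩
  have hp : p.Prime := Fact.out
  set q := p ^ n with hq
  have hq2 : 2 ≤ q := hp.two_le.trans (Nat.le_self_pow (by omega) p)
  have hpQ : (2 : ℚ) ≤ p := by exact_mod_cast hp.two_le
  have hqQ : (2 : ℚ) ≤ q := by exact_mod_cast hq2
  have hqcast : (p : ℚ) ^ n = q := by rw [hq]; push_cast; rfl
  have hp0 : ((p : ℕ) : Omg p) ≠ 0 := by
    have h1 : algebraMap (Kzero p) (Omg p)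
        (algebraMap (WittVector p (AlgebraicClosure (ZMod p))) (Kzero p) (p : ℕ)) ≠ 0 := by
      rw [_root_.map_ne_zero]
      exact (map_ne_zero_iff _ (IsFractionRing.injective _ (Kzero p))).2 (WittVector.p_nonzero p _)
    simpa using h1
  have hζ1 : ζ - 1 ≠ 0 := sub_ne_zero.2 (hζ.ne_one hp.one_lt)
  have hμ0 : μ ≠ 0 := by
    rintro rfl
    rw [zero_pow (by omega)] at hμ
    exact hζ1 hμ.symm
  set e : ℕ := (p - 1) * (q + 1) with he
  have hvμ : (e : ℚ) * v μ = 1 := by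
    have h1 := h.sub_one_mul_map_sub_one hp hv_p hζ
    rw [← hμ, h.map_pow hμ0] at h1
    rw [he, Nat.cast_mul, Nat.cast_sub hp.one_le]
    push_cast at h1 ⊢
    linarith
  have hep : e.Coprime p := by
    refine Nat.Coprime.mul_left ?_ ?_
    · exact (Nat.coprime_self_sub_left hp.one_le).2 (Nat.coprime_one_left p)
    · rw [hq, ← Nat.succ_pred_eq_of_pos hn, pow_succ']
      simp
  have he0 : 0 < e := Nat.mul_pos (by have := hp.two_le; omega) (by omega)
  have hcomp : ((cyclotomic p (Kzero p)).comp (X ^ (q + 1) + 1)).natDegree = e := by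
    rw [natDegree_comp, natDegree_cyclotomic, Nat.totient_prime hp, he]
    congr 1
    exact natDegree_X_pow_add_C (r := (1 : Kzero p))
  have hK : ∀ x : ↥(IntermediateField.adjoin (Kzero p) {μ}), (x : Omg p) ≠ 0 →
      ∃ m : ℤ, (e : ℚ) * v (x : Omg p) = m := by
    refine h.exists_int_of_mem_adjoin (exists_int_of_wittVector h hv_p hv_W) hμ0 hvμ
      (g := (cyclotomic p (Kzero p)).comp (X ^ (q + 1) + 1)) ?_ hcomp.le ?_
    · intro h0
      rw [h0, natDegree_zero] at hcomp
      omega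
    · have hroot : IsRoot (cyclotomic p (Omg p)) ζ := hζ.isRoot_cyclotomic hp.pos
      rw [aeval_comp]
      simp only [map_add, map_pow, aeval_X, map_one, hμ, sub_add_cancel]
      rw [← map_cyclotomic p (algebraMap (Kzero p) (Omg p)), IsRoot, eval_map_algebraMap] at hroot
      exact hroot
  set N : ℕ := ∑ i ∈ Finset.range n, p ^ (i + 1) with hN
  have hNp : p ∣ N := Finset.dvd_sum fun i _ => dvd_pow_self p (Nat.succ_ne_zero i)
  have hA0 : aCoef (Omg p) p n ≠ 0 := by
    unfold aCoef
    exact mul_ne_zero (pow_ne_zero _ (neg_ne_zero.2 one_ne_zero))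
      (pow_ne_zero _ (neg_ne_zero.2 hp0))
  have hvA : v (aCoef (Omg p) p n) = N := by
    unfold aCoef
    rw [h.map_mul _ _ (pow_ne_zero _ (neg_ne_zero.2 one_ne_zero))
      (pow_ne_zero _ (neg_ne_zero.2 hp0)), h.map_pow (neg_ne_zero.2 one_ne_zero),
      h.map_pow (neg_ne_zero.2 hp0), h.map_neg, h.map_neg, h.map_one, hv_p]
    simp [hN]
  have hNeq : ((p : ℚ) - 1) * N = p * ((q : ℚ) - 1) := by
    rw [← hqcast]
    exact sub_one_mul_sum_pow p n
  have hvA_pos : 0 < v (aCoef (Omg p) p n) := by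
    rw [hvA]
    by_contra! hle
    nlinarith [mul_nonneg_of_nonpos_of_nonpos hle (by linarith : 1 - (p : ℚ) ≤ 0)]
  have hvc_pos : 0 < v (c : Omg p) := by
    rw [hvc]
    positivity
  have hlt : ((q : ℚ) ^ 2 - 1) * v (c : Omg p) < v (aCoef (Omg p) p n) := by
    have h1 : (0 : ℚ) < (p : ℚ) - 1 := by linarith
    rw [hqcast, ← hvc, lt_div_iff₀ (by positivity)] at hc_lt
    rw [hvA, ← mul_lt_mul_iff_right₀ h1, hNeq]
    have h2 : (0 : ℚ) < (q : ℚ) - 1 := by linarith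
    nlinarith [mul_lt_mul_of_pos_right hc_lt h2]
  set L := Lpoly ↥(IntermediateField.adjoin (Kzero p) {μ}) p n c with hL
  have hcoeff : L.coeff (q * q) ≠ 0 := by
    rw [hL, hq, coeff_Lpoly, sub_ne_zero]
    intro h1
    have h2 := congrArg (algebraMap ↥(IntermediateField.adjoin (Kzero p) {μ}) (Omg p)) h1
    rw [aCoef_map, map_one] at h2
    rw [← h2, h.map_one] at hvA_pos
    exact lt_irrefl _ hvA_pos
  have hL0 : L ≠ 0 := by
    intro h0
    rw [h0, coeff_zero] at hcoeff
    exact hcoeff rfl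
  have hLdeg : L.natDegree = q * q :=
    le_antisymm (natDegree_Lpoly_le p n c) (le_natDegree_of_ne_zero hcoeff)
  have hdvd : ∀ g, g ∣ L → q * q ∣ g.natDegree := by
    intro g hgL
    have hg0 : g ≠ 0 := ne_zero_of_dvd_ne_zero hL0 hgL
    set ι := algebraMap ↥(IntermediateField.adjoin (Kzero p) {μ}) (Omg p)
    have hroots : ∀ y, (g.map ι).IsRoot y → y ≠ 0 ∧
        v y = (v (aCoef (Omg p) p n) + v (c : Omg p)) / (q : ℚ) ^ 2 := by
      intro y hy
      refine h.map_root hq2 hA0 hc0 hvA_pos hvc_pos hlt ?_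
      have h1 : aeval y L = 0 := by
        rw [IsRoot, eval_map_algebraMap] at hy
        exact aeval_eq_zero_of_dvd_aeval_eq_zero hgL hy
      rw [hL, aeval_Lpoly, sub_eq_zero] at h1
      exact h1
    obtain ⟨h1, h2⟩ := h.natDegree_mul_eq (Polynomial.map_ne_zero (f := ι) hg0) hroots
    rw [natDegree_map, leadingCoeff_map, coeff_map, hvA, hvc] at h2
    rw [coeff_map] at h1
    have h3 : ι g.leadingCoeff ≠ 0 := by simpa using hg0
    obtain ⟨m, hm⟩ := hK (g.coeff 0) h1
    obtain ⟨m', hm'⟩ := hK g.leadingCoeff h3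
    refine sq_dvd_of_slope (n := n) (t := m - m') hb hap hep hNp ?_
    rw [h2, mul_sub]
    push_cast
    exact congrArg₂ (· - ·) hm hm'
  have hqq : 0 < q * q := by positivity
  refine ⟨fun hu => ?_, fun f g hfg => ?_⟩
  · have := natDegree_eq_zero_of_isUnit hu
    omega
  · have hf0 : f ≠ 0 := left_ne_zero_of_mul (hfg ▸ hL0)
    have hg0 : g ≠ 0 := right_ne_zero_of_mul (hfg ▸ hL0)
    have hsum : f.natDegree + g.natDegree = q * q := by
      rw [← natDegree_mul hf0 hg0, ← hfg, hLdeg]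
    have hunit : ∀ r : Polynomial ↥(IntermediateField.adjoin (Kzero p) {μ}), r ≠ 0 →
        r.natDegree = 0 → IsUnit r := fun r hr hr0 =>
      isUnit_iff_degree_eq_zero.2 (by rw [degree_eq_natDegree hr, hr0]; rfl)
    rcases Nat.eq_zero_or_pos f.natDegree with h1 | h1
    · exact Or.inl (hunit f hf0 h1)
    · refine Or.inr (hunit g hg0 ?_)
      have := Nat.le_of_dvd h1 (hdvd f ⟨g, hfg⟩)
      omega
end
end

section
/- Assume c ∈ O_K with v(c^p − c) ≥ 1 and v(c) < p/((q+1)(p−1)), and let y ∈ Ω be a root of L_c(X). Set h := y^{q²/p}/b_n − c. Then v(h) = v(y)/p, one has v(p·y^{q/p}·h) = 1 + (q²−1)/((p−1)·q²), and there exist u ∈ K(y) and r ∈ Ω with v(r) > 1 + (q²−1)/((p−1)·q²) such that f_{q,c}(y)·u^p = 1 + p·y^{q/p}·h + r. (Here q²/p = p^{2n−1} and q/p = p^{n−1}.) -/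
open Polynomial

noncomputable section

/-- `b_n = −(−p)^(1 + p + ⋯ + p^(n−1))`, so that `b_n^p = a_n`. -/
def bCoef (R : Type) [CommRing R] (p n : ℕ) : R :=
  -(-(p : R)) ^ (Finset.sum (Finset.range n) fun i => p ^ i)

set_option maxHeartbeats 1000000

/-- A map `v : F → ℚ` that restricts to an additive valuation on the nonzero elements of `F`. -/
structure IsRatVal {F : Type} [Field F] (v : F → ℚ) : Prop where
  map_mul : ∀ x y : F, x ≠ 0 → y ≠ 0 → v (x * y) = v x + v y
  map_add : ∀ x y : F, x ≠ 0 → y ≠ 0 → x + y ≠ 0 → min (v x) (v y) ≤ v (x + y)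

namespace IsRatVal

variable {F : Type} [Field F] {v : F → ℚ}

theorem map_one (hv : IsRatVal v) : v 1 = 0 := by
  have := hv.map_mul 1 1 one_ne_zero one_ne_zero
  rw [mul_one] at this
  linarith

theorem map_neg (hv : IsRatVal v) (x : F) : v (-x) = v x := by
  have hne : (-1 : F) ≠ 0 := neg_ne_zero.mpr one_ne_zero
  have h1 := hv.map_mul (-1) (-1) hne hne
  rw [neg_mul_neg, one_mul, hv.map_one] at h1
  by_cases hx : x = 0
  · rw [hx, neg_zero]
  · have h2 := hv.map_mul (-1) x hne hx
    rw [neg_one_mul] at h2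
    linarith

theorem map_pow (hv : IsRatVal v) {x : F} (hx : x ≠ 0) (k : ℕ) : v (x ^ k) = k * v x := by
  induction k with
  | zero => simp [hv.map_one]
  | succ k ih =>
    rw [pow_succ, hv.map_mul _ _ (pow_ne_zero _ hx) hx, ih]
    push_cast
    ring

theorem map_div (hv : IsRatVal v) {x y : F} (hx : x ≠ 0) (hy : y ≠ 0) :
    v (x / y) = v x - v y := by
  have := hv.map_mul (x / y) y (div_ne_zero hx hy) hy
  rw [div_mul_cancel₀ _ hy] at this
  linarith

/-- The closed ball `{x | r ≤ v x}`, where zero has infinite valuation. -/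
def ball (hv : IsRatVal v) (r : ℚ) : AddSubgroup F where
  carrier := {x | x = 0 ∨ r ≤ v x}
  zero_mem' := Or.inl rfl
  neg_mem' := by
    rintro x (rfl | hx)
    · exact Or.inl neg_zero
    · exact Or.inr (by rwa [hv.map_neg])
  add_mem' := by
    rintro x y hx hy
    by_cases hx0 : x = 0
    · simpa [hx0] using hy
    by_cases hy0 : y = 0
    · simpa [hy0] using hx
    by_cases hxy : x + y = 0
    · exact Or.inl hxy
    · exact Or.inr ((le_min (hx.resolve_left hx0) (hy.resolve_left hy0)).trans
        (hv.map_add x y hx0 hy0 hxy))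

theorem mem_ball_of_le (hv : IsRatVal v) {r : ℚ} {x : F} (h : r ≤ v x) : x ∈ hv.ball r := Or.inr h

theorem le_of_mem_ball (hv : IsRatVal v) {r : ℚ} {x : F} (h : x ∈ hv.ball r) (hx : x ≠ 0) :
    r ≤ v x :=
  Or.resolve_left h hx

theorem ball_mono (hv : IsRatVal v) {r s : ℚ} (h : r ≤ s) {x : F} (hx : x ∈ hv.ball s) :
    x ∈ hv.ball r :=
  Or.imp_right (le_trans h) hx

theorem mul_mem_ball (hv : IsRatVal v) {r s : ℚ} {x y : F} (hx : x ∈ hv.ball r)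
    (hy : y ∈ hv.ball s) : x * y ∈ hv.ball (r + s) := by
  by_cases hx0 : x = 0
  · exact Or.inl (by simp [hx0])
  by_cases hy0 : y = 0
  · exact Or.inl (by simp [hy0])
  right
  rw [hv.map_mul x y hx0 hy0]
  exact add_le_add (hv.le_of_mem_ball hx hx0) (hv.le_of_mem_ball hy hy0)

theorem mul_mem_ball_of_le (hv : IsRatVal v) {r s t : ℚ} {x y : F} (hx : x ∈ hv.ball r)
    (hy : y ∈ hv.ball s) (h : t ≤ r + s) : x * y ∈ hv.ball t :=
  hv.ball_mono h (hv.mul_mem_ball hx hy)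

theorem one_mem_ball (hv : IsRatVal v) : (1 : F) ∈ hv.ball 0 := Or.inr hv.map_one.ge

/-- The valuation ring of `v`. -/
def integer (hv : IsRatVal v) : Subring F where
  __ := hv.ball 0
  one_mem' := hv.one_mem_ball
  mul_mem' := fun hx hy => hv.mul_mem_ball_of_le hx hy (by norm_num)

theorem mem_integer (hv : IsRatVal v) {x : F} : x ∈ hv.integer ↔ x ∈ hv.ball 0 := Iff.rfl

theorem pow_mem_ball (hv : IsRatVal v) {x : F} (hx : x ∈ hv.ball 0) (k : ℕ) :
    x ^ k ∈ hv.ball 0 :=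
  pow_mem (hv.mem_integer.mpr hx) k

theorem add_ne_zero_and_map_add_eq (hv : IsRatVal v) {r : ℚ} {x e : F} (hx : x ≠ 0)
    (he : e ∈ hv.ball r) (h : v x < r) : x + e ≠ 0 ∧ v (x + e) = v x := by
  by_cases he0 : e = 0
  · simp [he0, hx]
  have her := hv.le_of_mem_ball he he0
  have hne : x + e ≠ 0 := by
    intro h0
    rw [eq_neg_of_add_eq_zero_left h0, hv.map_neg] at h
    linarith
  refine ⟨hne, le_antisymm ?_ ?_⟩
  · by_contra! hlt
    have h1 := hv.map_add (x + e) (-e) hne (neg_ne_zero.mpr he0) (by simpa using hx)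
    rw [add_neg_cancel_right, hv.map_neg] at h1
    exact absurd (lt_min hlt (h.trans_le her)) (not_lt.mpr h1)
  · have h1 := hv.map_add x e hx he0 hne
    rwa [min_eq_left (by linarith)] at h1

theorem pow_sub_one_mem_ball (hv : IsRatVal v) {r : ℚ} (hr : 0 ≤ r) {x : F}
    (hx : x - 1 ∈ hv.ball r) (k : ℕ) : x ^ k - 1 ∈ hv.ball r := by
  have hx0 : x ∈ hv.ball 0 := by
    have := add_mem (hv.ball_mono hr hx) hv.one_mem_ball
    rwa [sub_add_cancel] at this
  induction k with
  | zero => simp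
  | succ k ih =>
    have : x ^ (k + 1) - 1 = x * (x ^ k - 1) + (x - 1) := by ring
    rw [this]
    exact add_mem (hv.mul_mem_ball_of_le hx0 ih (by simp)) hx

end IsRatVal

theorem exists_one_add_pow_prime_eq {R : Type} [CommRing R] {p : ℕ} (hp : p.Prime) (a : R) :
    ∃ r, (1 + a) ^ p = 1 + a ^ p + p * a + p * a ^ 2 * r := by
  have h1 := add_pow_prime_eq hp a 1
  set S := ∑ k ∈ Finset.Ioo 0 p, a ^ (k - 1) * 1 ^ (p - k - 1) * ((p.choose k / p : ℕ) : R)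
    with hS
  have hd : a ∣ S - 1 := by
    have hmem : 1 ∈ Finset.Ioo 0 p := Finset.mem_Ioo.mpr ⟨one_pos, hp.one_lt⟩
    rw [hS, ← Finset.add_sum_erase _ _ hmem]
    simp only [Nat.sub_self, pow_zero, one_pow, mul_one, Nat.choose_one_right,
      Nat.div_self hp.pos, Nat.cast_one, add_sub_cancel_left]
    refine Finset.dvd_sum fun k hk => Dvd.dvd.mul_right (dvd_pow_self a ?_) _
    rw [Finset.mem_erase, Finset.mem_Ioo] at hk
    omega
  obtain ⟨r, hr⟩ := hd
  refine ⟨r, ?_⟩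
  rw [add_comm 1 a, h1, sub_eq_iff_eq_add.mp hr]
  ring

namespace IsRatVal

variable {F : Type} [Field F] {v : F → ℚ}

theorem exists_add_pow_prime_eq (hv : IsRatVal v) {p : ℕ} (hp : p.Prime) {a b : F}
    (ha : a ∈ hv.ball 0) (hb : b ∈ hv.ball 0) :
    ∃ r ∈ hv.ball 0, (a + b) ^ p = a ^ p + b ^ p + p * r := by
  obtain ⟨r, hr⟩ := _root_.exists_add_pow_prime_eq hp (⟨a, ha⟩ : hv.integer) ⟨b, hb⟩
  refine ⟨a * b * r, hv.mul_mem_ball_of_le (hv.mul_mem_ball ha hb) r.2 (by norm_num), ?_⟩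
  have := congrArg Subtype.val hr
  push_cast at this
  rw [this]
  ring

theorem exists_one_add_pow_prime_eq (hv : IsRatVal v) {p : ℕ} (hp : p.Prime) {a : F}
    (ha : a ∈ hv.ball 0) :
    ∃ r ∈ hv.ball 0, (1 + a) ^ p = 1 + a ^ p + p * a + p * a ^ 2 * r := by
  obtain ⟨r, hr⟩ := _root_.exists_one_add_pow_prime_eq hp (⟨a, ha⟩ : hv.integer)
  refine ⟨r, r.2, ?_⟩
  have := congrArg Subtype.val hr
  push_cast at this
  exact this

/-- Multiplying by `(1 + z) ^ p` trades the term `-z ^ p` for `p * z`, up to a small error. -/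
theorem mul_one_add_pow_prime (hv : IsRatVal v) {p : ℕ} (hp : p.Prime) (hvp : v (p : F) = 1)
    {m s : ℚ} (hm : 0 ≤ m) (hs2 : s ≤ 2) (hsm : s ≤ 1 + 2 * m) {B z e : F}
    (hB : B ∈ hv.ball 1) (hz : z ∈ hv.ball m) (hzp : z ^ p ∈ hv.ball 1) (he : e ∈ hv.ball s) :
    ∃ e' ∈ hv.ball s, (1 + B - z ^ p + e) * (1 + z) ^ p = 1 + B + p * z + e' := by
  have hz0 := hv.ball_mono hm hz
  obtain ⟨r, hr, hpow⟩ := hv.exists_one_add_pow_prime_eq hp hz0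
  have hpm : (p : F) ∈ hv.ball 1 := hv.mem_ball_of_le hvp.ge
  have h1z : (1 + z) ^ p ∈ hv.ball 0 := hv.pow_mem_ball (add_mem hv.one_mem_ball hz0) p
  have hz2 : z ^ 2 ∈ hv.ball (2 * m) := by
    rw [sq]
    exact hv.mul_mem_ball_of_le hz hz (by linarith)
  have hpz : (p : F) * z ∈ hv.ball 1 := hv.mul_mem_ball_of_le hpm hz0 (by norm_num)
  have hpz2 : (p : F) * z ^ 2 * r ∈ hv.ball (1 + 2 * m) :=
    hv.mul_mem_ball_of_le (hv.mul_mem_ball hpm hz2) hr (by linarith)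
  have hprod : (B - z ^ p) * (z ^ p + p * z + p * z ^ 2 * r) ∈ hv.ball s :=
    hv.mul_mem_ball_of_le (sub_mem hB hzp)
      (add_mem (add_mem hzp hpz) (hv.ball_mono (by linarith) hpz2)) (by linarith)
  refine ⟨e * (1 + z) ^ p + (B - z ^ p) * (z ^ p + p * z + p * z ^ 2 * r) + p * z ^ 2 * r,
    add_mem (add_mem (hv.mul_mem_ball_of_le he h1z (by simp)) hprod)
      (hv.ball_mono hsm hpz2), ?_⟩
  rw [hpow]
  ring

/-- Along a sequence with `d j ^ p = -p * d (j + 1)`, the term `p * d j` can be replaced by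
`p * d 0` after multiplication by a `p`-th power. -/
theorem exists_mul_pow_prime_descend (hv : IsRatVal v) {p : ℕ} (hp : p.Prime)
    (hvp : v (p : F) = 1) {m s : ℚ} (hm : 0 ≤ m) (hs2 : s ≤ 2) (hsm : s ≤ 1 + 2 * m)
    (L : Subfield F) (d : ℕ → F) (hdL : ∀ j, d j ∈ L) (hd : ∀ j, d j ^ p = -p * d (j + 1))
    {N : ℕ} (hdm : ∀ j ≤ N, d j ∈ hv.ball m) {f B : F} (hB : B ∈ hv.ball 1) :
    (∃ u ∈ L, ∃ e ∈ hv.ball s, f * u ^ p = 1 + B + p * d N + e) →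
      ∃ u ∈ L, ∃ e ∈ hv.ball s, f * u ^ p = 1 + B + p * d 0 + e := by
  induction N with
  | zero => exact id
  | succ N ih =>
    rintro ⟨u, hu, e, he, hfu⟩
    have hpm : (p : F) ∈ hv.ball 1 := hv.mem_ball_of_le hvp.ge
    have hzp : d N ^ p ∈ hv.ball 1 := by
      rw [hd N]
      exact hv.mul_mem_ball_of_le (neg_mem hpm) (hdm (N + 1) le_rfl) (by linarith)
    obtain ⟨e', he', h⟩ := hv.mul_one_add_pow_prime hp hvp hm hs2 hsm hB
      (hdm N (Nat.le_succ N)) hzp he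
    refine ih (fun j hj => hdm j (hj.trans (Nat.le_succ N)))
      ⟨u * (1 + d N), L.mul_mem hu (L.add_mem L.one_mem (hdL N)), e', he', ?_⟩
    rw [← h, mul_pow, ← mul_assoc, hfu, hd N]
    ring

end IsRatVal

theorem eval_fqc {R : Type} [CommRing R] (p n : ℕ) (c y : R) :
    (fqc R p n c).eval y = 1 + (c + y) * y ^ p ^ n := by
  simp only [fqc, eval_add, eval_one, eval_mul, eval_C, eval_pow, eval_X]
  ring

theorem geom_sum_rat {p : ℕ} (hp : p.Prime) (k : ℕ) :
    ((∑ i ∈ Finset.range k, p ^ i : ℕ) : ℚ) = ((p : ℚ) ^ k - 1) / ((p : ℚ) - 1) := by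
  have hp1 : (1 : ℚ) < p := by exact_mod_cast hp.one_lt
  rw [eq_div_iff (by linarith)]
  push_cast
  exact geom_sum_mul (p : ℚ) k

theorem bCoef_pow {R : Type} [CommRing R] {p n : ℕ} (hn : 1 ≤ n) :
    bCoef R p n ^ p = aCoef R p n := by
  have hsign : (-1 : R) ^ p ^ n = (-1) ^ p := by
    rcases p.even_or_odd with he | ho
    · rw [he.neg_one_pow, (he.pow_of_ne_zero (by omega)).neg_one_pow]
    · rw [ho.neg_one_pow, ho.pow.neg_one_pow]
  rw [bCoef, aCoef, hsign, neg_pow, ← pow_mul, Finset.sum_mul]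
  simp only [pow_succ]

/-- If `w ^ p ≡ w` modulo `p`, then `(-w) ^ p ≡ -w` modulo `p`, for every prime `p`. -/
theorem IsRatVal.add_neg_pow_mem_ball {F : Type} [Field F] {v : F → ℚ} (hv : IsRatVal v) {p : ℕ}
    (hp : p.Prime) (hvp : v (p : F) = 1) {c : F} (hc : c ∈ hv.ball 0)
    (hcp : c ^ p - c ∈ hv.ball 1) : c + (-c) ^ p ∈ hv.ball 1 := by
  rcases hp.eq_two_or_odd' with rfl | ho
  · have h2 : ((2 : ℕ) : F) * c ∈ hv.ball 1 :=
      hv.mul_mem_ball_of_le (hv.mem_ball_of_le hvp.ge) hc (by norm_num)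
    have : c + (-c) ^ 2 = (c ^ 2 - c) + ((2 : ℕ) : F) * c := by
      push_cast
      ring
    rw [this]
    exact add_mem hcp h2
  · rw [ho.neg_pow, ← neg_mem_iff]
    convert hcp using 1
    ring

theorem IsRatVal.map_root_eq {F : Type} [Field F] {v : F → ℚ} (hv : IsRatVal v) {q : ℕ}
    (hq : 1 ≤ q) {a c y : F} (ha : a ≠ 0) (hva : 0 < v a) (hc : c ≠ 0) (hvc : v c = 0)
    (hy : y ^ (q * q) = a * (c + y) * (1 + (c + y) * y ^ q) ^ (q - 1)) :
    y ≠ 0 ∧ v y = v a / (q : ℚ) ^ 2 := by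
  have hq0 : (0 : ℚ) < q := by exact_mod_cast hq
  have hy0 : y ≠ 0 := by
    rintro rfl
    rw [zero_pow (by positivity), zero_pow (by omega)] at hy
    simp [ha, hc] at hy
  refine ⟨hy0, ?_⟩
  have hlhs := hv.map_pow hy0 (q * q)
  have hcO : c ∈ hv.ball 0 := hv.mem_ball_of_le hvc.ge
  have hv_rhs (h1 : c + y ≠ 0) (h2 : 1 + (c + y) * y ^ q ≠ 0) :
      (q : ℚ) ^ 2 * v y = v a + v (c + y) + ((q : ℚ) - 1) * v (1 + (c + y) * y ^ q) := by
    rw [hy, hv.map_mul _ _ (mul_ne_zero ha h1) (pow_ne_zero _ h2), hv.map_mul _ _ ha h1,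
      hv.map_pow h2] at hlhs
    push_cast [Nat.cast_sub hq] at hlhs
    linarith
  rcases lt_trichotomy (v y) 0 with hneg | hzero | hpos
  · obtain ⟨h1, hv1⟩ := hv.add_ne_zero_and_map_add_eq hy0 hcO hneg
    rw [add_comm] at h1 hv1
    have hprod : (c + y) * y ^ q ≠ 0 := mul_ne_zero h1 (pow_ne_zero _ hy0)
    have hvprod : v ((c + y) * y ^ q) = (q + 1) * v y := by
      rw [hv.map_mul _ _ h1 (pow_ne_zero _ hy0), hv.map_pow hy0, hv1]
      ring
    obtain ⟨h2, hv2⟩ := hv.add_ne_zero_and_map_add_eq hprod hv.one_mem_ball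
      (by rw [hvprod]; exact mul_neg_of_pos_of_neg (by linarith) hneg)
    rw [add_comm] at h2 hv2
    have := hv_rhs h1 h2
    rw [hv1, hv2, hvprod] at this
    linarith
  · have hyO : y ∈ hv.ball 0 := hv.mem_ball_of_le hzero.ge
    have hcy := add_mem hcO hyO
    have hfO : 1 + (c + y) * y ^ q ∈ hv.ball 0 :=
      add_mem hv.one_mem_ball (hv.mul_mem_ball_of_le hcy (hv.pow_mem_ball hyO q) (by simp))
    have := hv.mul_mem_ball (hv.mul_mem_ball (hv.mem_ball_of_le (le_refl (v a))) hcy)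
      (hv.pow_mem_ball hfO (q - 1))
    rw [← hy] at this
    have := hv.le_of_mem_ball this (pow_ne_zero _ hy0)
    rw [hlhs, hzero] at this
    linarith
  · obtain ⟨h1, hv1⟩ := hv.add_ne_zero_and_map_add_eq hc (hv.mem_ball_of_le le_rfl)
      (by rwa [hvc] : v c < v y)
    have hq1 : (1 : ℚ) ≤ q := by exact_mod_cast hq
    have hprod : (c + y) * y ^ q ∈ hv.ball (v y) := by
      refine hv.mem_ball_of_le ?_
      rw [hv.map_mul _ _ h1 (pow_ne_zero _ hy0), hv.map_pow hy0, hv1, hvc]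
      nlinarith
    obtain ⟨h2, hv2⟩ := hv.add_ne_zero_and_map_add_eq one_ne_zero hprod
      (by rwa [hv.map_one])
    have := hv_rhs h1 h2
    rw [hv1, hv2, hvc, hv.map_one] at this
    rw [eq_div_iff (by positivity)]
    linarith

/-- For a root `y` of `L_c`, the value `f_{q,c}(y)` is `1 + p * y ^ (q / p) * h` up to a `p`-th
power and an error of larger valuation, over an arbitrary valued field. -/
theorem IsRatVal.fqc_mul_pow_prime {F : Type} [Field F] {v : F → ℚ} (hv : IsRatVal v)
    {p n : ℕ} (hp : p.Prime) (hp0 : (p : F) ≠ 0) (hn : 1 ≤ n) (hvp : v (p : F) = 1) (L : Subfield F) {c y h : F}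
    (hcL : c ∈ L) (hyL : y ∈ L) (hc : c ≠ 0) (hvc : v c = 0) (hcp : c ^ p - c ∈ hv.ball 1)
    (hy : y ^ (p ^ n * p ^ n) =
      aCoef F p n * (c + y) * (1 + (c + y) * y ^ p ^ n) ^ (p ^ n - 1))
    (hh : h = y ^ p ^ (2 * n - 1) / bCoef F p n - c) :
    v h = v y / (p : ℚ) ∧
    v ((p : F) * y ^ p ^ (n - 1) * h) =
      1 + ((p : ℚ) ^ (2 * n) - 1) / (((p : ℚ) - 1) * (p : ℚ) ^ (2 * n)) ∧
    ∃ u r : F, u ∈ L ∧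
      (r = 0 ∨ 1 + ((p : ℚ) ^ (2 * n) - 1) / (((p : ℚ) - 1) * (p : ℚ) ^ (2 * n)) < v r) ∧
      (1 + (c + y) * y ^ p ^ n) * u ^ p = 1 + (p : F) * y ^ p ^ (n - 1) * h + r := by
  obtain ⟨k, rfl⟩ : ∃ k, n = k + 1 := ⟨n - 1, by omega⟩
  have hk : k + 1 - 1 = k := rfl
  have h2k : 2 * (k + 1) - 1 = 2 * k + 1 := by omega
  rw [h2k] at hh
  rw [hk]
  set P : ℚ := (p : ℚ) with hP
  set Q : ℚ := P ^ (k + 1) with hQ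
  have hP2 : 2 ≤ P := by rw [hP]; exact_mod_cast hp.two_le
  have hQP : P ≤ Q := le_self_pow₀ (by linarith) (by omega)
  have hQ0 : 0 < Q := by linarith
  have hP10 : 0 < P - 1 := by linarith
  have hnp0 : -(p : F) ≠ 0 := neg_ne_zero.mpr hp0
  have hvnp : v (-(p : F)) = 1 := by rw [hv.map_neg, hvp]
  have hpm : (p : F) ∈ hv.ball 1 := hv.mem_ball_of_le hvp.ge
  have hcO : c ∈ hv.ball 0 := hv.mem_ball_of_le hvc.ge
  have hb0 : bCoef F p (k + 1) ≠ 0 := neg_ne_zero.mpr (pow_ne_zero _ hnp0)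
  have hba := bCoef_pow (R := F) (p := p) hn
  have ha0 : aCoef F p (k + 1) ≠ 0 := hba ▸ pow_ne_zero _ hb0
  have hvb : v (bCoef F p (k + 1)) = (Q - 1) / (P - 1) := by
    rw [bCoef, hv.map_neg, hv.map_pow hnp0, hvnp, mul_one, geom_sum_rat hp]
  have hva : v (aCoef F p (k + 1)) = P * ((Q - 1) / (P - 1)) := by
    rw [← hba, hv.map_pow hb0, hvb]
  have hva_pos : 0 < v (aCoef F p (k + 1)) := by
    rw [hva]
    have : 0 < Q - 1 := by linarith
    positivity
  obtain ⟨hy0, hvy⟩ := hv.map_root_eq (Nat.one_le_pow _ _ hp.pos) ha0 hva_pos hc hvc hy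
  have hQcast : ((p ^ (k + 1) : ℕ) : ℚ) = Q := by push_cast; rfl
  rw [hQcast, hva] at hvy
  set m : ℚ := (1 - 1 / Q) / (P - 1) with hm
  have hmP : m * (P - 1) = 1 - 1 / Q := div_mul_cancel₀ _ hP10.ne'
  have hQinv : 1 / Q ≤ 1 / P := one_div_le_one_div_of_le (by linarith) hQP
  have hPinv : 1 / P ≤ 1 / 2 := one_div_le_one_div_of_le (by norm_num) hP2
  have hQinv0 : 0 < 1 / Q := by positivity
  have hPP : P * (1 / P) = 1 := mul_one_div_cancel (by linarith)
  have hm0 : 0 < m := by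
    rw [hm]
    apply div_pos _ hP10
    linarith
  have hvym : v y = P * m * (1 / Q) := by
    rw [hvy, hm]
    field_simp
  have hQQ : Q * (1 / Q) = 1 := mul_one_div_cancel hQ0.ne'
  have hPm1 : 1 ≤ P * m := by
    have : 1 * (P - 1) ≤ P * m * (P - 1) := by
      rw [mul_assoc, hmP]
      nlinarith
    exact le_of_mul_le_mul_right this hP10
  have hm1 : m * (1 + 1 / Q) < 1 := by
    have : m * (1 + 1 / Q) * (P - 1) < 1 * (P - 1) := by
      have : m * (1 + 1 / Q) * (P - 1) = 1 - (1 / Q) ^ 2 := by linear_combination (1 + 1 / Q) * hmP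
      rw [this]
      nlinarith [sq_nonneg (1 / Q), pow_pos hQinv0 2]
    exact lt_of_mul_lt_mul_right this hP10.le
  have hvy_pos : 0 < v y := by rw [hvym]; positivity
  have hvy1 : v y < 1 := by
    have h1 : P * (1 / Q) ≤ 1 := by nlinarith
    have h2 : m < 1 := by nlinarith
    rw [hvym]
    nlinarith
  have hQvy : Q * v y = P * m := by rw [hvym]; linear_combination P * m * hQQ
  have hvY1 : v (y ^ p ^ k) = m := by
    have hQk : Q = P ^ k * P := pow_succ P k
    rw [hv.map_pow hy0]
    push_cast
    have : (P ^ k * v y) * P = m * P := by rw [hQk] at hQvy; linarith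
    exact mul_right_cancel₀ (by linarith) this
  have hyO : y ∈ hv.ball 0 := hv.mem_ball_of_le hvy_pos.le
  have hyq : y ^ p ^ (k + 1) ∈ hv.ball 1 := by
    refine hv.mem_ball_of_le ?_
    rw [hv.map_pow hy0, hQcast, hQvy]
    exact hPm1
  have hcyO := add_mem hcO hyO
  have hcyq : (c + y) * y ^ p ^ (k + 1) ∈ hv.ball 1 := hv.mul_mem_ball_of_le hcyO hyq (by norm_num)
  have hs : 1 + (P ^ (2 * (k + 1)) - 1) / ((P - 1) * P ^ (2 * (k + 1))) = 1 + m * (1 + 1 / Q) := by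
    rw [mul_comm 2, pow_mul, ← hQ, hm]
    field_simp
    ring
  rw [hs]
  set t : F := y ^ p ^ (2 * k + 1) / bCoef F p (k + 1) with ht
  have htp : t ^ p = (c + y) * (1 + (c + y) * y ^ p ^ (k + 1)) ^ (p ^ (k + 1) - 1) := by
    rw [ht, div_pow, hba, div_eq_iff ha0, ← pow_mul]
    have : p ^ (2 * k + 1) * p = p ^ (k + 1) * p ^ (k + 1) := by ring
    rw [this, hy]
    ring
  have ht0 : t ≠ 0 := div_ne_zero (pow_ne_zero _ hy0) hb0
  have hfp := hv.pow_sub_one_mem_ball zero_le_one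
    (by simpa using hcyq : 1 + (c + y) * y ^ p ^ (k + 1) - 1 ∈ hv.ball 1) (p ^ (k + 1) - 1)
  set g : F := (1 + (c + y) * y ^ p ^ (k + 1)) ^ (p ^ (k + 1) - 1) with hg
  have htO : t ∈ hv.ball 0 := by
    refine hv.mem_ball_of_le ?_
    have hgO : g ∈ hv.ball 0 := by
      have := add_mem (hv.ball_mono zero_le_one hfp) hv.one_mem_ball
      rwa [sub_add_cancel] at this
    have := hv.mul_mem_ball hcyO hgO
    rw [← htp] at this
    have := hv.le_of_mem_ball this (pow_ne_zero _ ht0)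
    rw [hv.map_pow ht0, add_zero] at this
    exact nonneg_of_mul_nonneg_right this (by linarith)
  have hhO : h ∈ hv.ball 0 := hh ▸ sub_mem htO hcO
  have hthc : t = h + c := by rw [hh]; ring
  have hhp : h ^ p ≠ 0 ∧ v (h ^ p) = v y := by
    obtain ⟨R, hR, hpow⟩ := hv.exists_add_pow_prime_eq hp hhO hcO
    have herr : (c + y) * (g - 1) - (c ^ p - c) - p * R ∈ hv.ball 1 :=
      sub_mem (sub_mem (hv.mul_mem_ball_of_le hcyO hfp (by norm_num)) hcp)
        (hv.mul_mem_ball_of_le hpm hR (by norm_num))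
    have : h ^ p = y + ((c + y) * (g - 1) - (c ^ p - c) - p * R) := by
      rw [← hthc, htp] at hpow
      linear_combination -hpow
    rw [this]
    exact hv.add_ne_zero_and_map_add_eq hy0 herr hvy1
  have hh0 : h ≠ 0 := by
    rintro rfl
    exact hhp.1 (zero_pow hp.ne_zero)
  have hvh : v h = v y / P := by
    have := hhp.2
    rw [hv.map_pow hh0] at this
    rw [eq_div_iff (by linarith)]
    linarith
  have hvmain : v ((p : F) * y ^ p ^ k * h) = 1 + m * (1 + 1 / Q) := by
    rw [hv.map_mul _ _ (mul_ne_zero hp0 (pow_ne_zero _ hy0)) hh0,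
      hv.map_mul _ _ hp0 (pow_ne_zero _ hy0), hvp, hvY1, hvh, hvym]
    field_simp
    ring
  refine ⟨hvh, hvmain, ?_⟩
  -- Every error term has valuation at least `s`, which exceeds the valuation of the main term.
  obtain ⟨s, hs_lt, hs2, hsm⟩ : ∃ s, 1 + m * (1 + 1 / Q) < s ∧ s ≤ 2 ∧ s ≤ 1 + 2 * m := by
    refine ⟨min 2 (1 + 2 * m), lt_min (by linarith) ?_, min_le_left _ _, min_le_right _ _⟩
    nlinarith
  let d : ℕ → F := fun j =>
    y ^ ((p ^ (k + 1) + 1) * p ^ j) / (-(p : F)) ^ (∑ i ∈ Finset.range (j + 1), p ^ i)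
  have hdL (j : ℕ) : d j ∈ L := by
    refine L.div_mem (L.pow_mem hyL _) (L.pow_mem (L.neg_mem ?_) _)
    exact natCast_mem L p
  have hd (j : ℕ) : d j ^ p = -p * d (j + 1) := by
    simp only [d]
    rw [geom_sum_succ (n := j + 1), div_pow, ← pow_mul, ← pow_mul, pow_succ (-(p : F)),
      mul_comm p (∑ i ∈ Finset.range (j + 1), p ^ i), pow_succ p j, ← mul_assoc]
    field_simp
  have hd0 : p * d 0 = -y ^ (p ^ (k + 1) + 1) := by
    simp only [d]
    simp
    field_simp
  have hdk : d k = -(t * y ^ p ^ k) := by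
    have : (p ^ (k + 1) + 1) * p ^ k = p ^ (2 * k + 1) + p ^ k := by ring
    simp only [d]
    rw [this, ht, bCoef, pow_add]
    field_simp
  have hdm : ∀ j ≤ k, d j ∈ hv.ball m := by
    intro j hj
    refine hv.mem_ball_of_le ?_
    simp only [d]
    rw [hv.map_div (pow_ne_zero _ hy0) (pow_ne_zero _ hnp0), hv.map_pow hy0, hv.map_pow hnp0, hvnp,
      mul_one, geom_sum_rat hp]
    have hjk : P ^ (j + 1) ≤ Q := pow_le_pow_right₀ (by linarith) (by omega)
    have hle : P ^ (j + 1) * (1 / Q) ≤ 1 := by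
      exact (mul_le_mul_of_nonneg_right hjk hQinv0.le).trans hQQ.le
    have hval : (((p ^ (k + 1) + 1) * p ^ j : ℕ) : ℚ) * v y - (P ^ (j + 1) - 1) / (P - 1) =
        (1 - P ^ (j + 1) * (1 / Q) * (1 / Q)) / (P - 1) := by
      push_cast
      rw [← hP, ← hQ, hvym, hm]
      field_simp
      ring
    rw [hval, hm]
    apply div_le_div_of_nonneg_right _ hP10.le
    nlinarith
  have hY1m : -(c * y ^ p ^ k) ∈ hv.ball m :=
    neg_mem (hv.mul_mem_ball_of_le hcO (hv.mem_ball_of_le hvY1.ge) (by simp))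
  have hph : (p : F) * y ^ p ^ k * h ∈ hv.ball 1 := by
    refine hv.mem_ball_of_le ?_
    rw [hvmain]
    nlinarith
  have hB : y ^ (p ^ (k + 1) + 1) + p * y ^ p ^ k * h ∈ hv.ball 1 := by
    refine add_mem ?_ hph
    rw [pow_succ]
    exact hv.mul_mem_ball_of_le hyq hyO (by norm_num)
  have hstart : ∃ u ∈ L, ∃ e ∈ hv.ball s, (1 + (c + y) * y ^ p ^ (k + 1)) * u ^ p =
      1 + (y ^ (p ^ (k + 1) + 1) + p * y ^ p ^ k * h) + p * d k + e := by
    obtain ⟨R, hR, hpow⟩ := hv.exists_one_add_pow_prime_eq hp (hv.ball_mono hm0.le hY1m)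
    set w : F := -(c * y ^ p ^ k) with hw
    have hwp : w ^ p = (-c) ^ p * y ^ p ^ (k + 1) := by
      rw [hw, ← neg_mul, mul_pow, ← pow_mul, pow_succ]
    have hpw : (p : F) * w ∈ hv.ball 1 := hv.mul_mem_ball_of_le hpm hY1m (by linarith)
    have hw2 : (p : F) * w ^ 2 * R ∈ hv.ball (1 + 2 * m) := by
      rw [sq]
      exact hv.mul_mem_ball_of_le (hv.mul_mem_ball hpm (hv.mul_mem_ball hY1m hY1m)) hR
        (by linarith)
    have hwp1 : w ^ p ∈ hv.ball 1 := by
      rw [hwp]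
      exact hv.mul_mem_ball_of_le (hv.pow_mem_ball (neg_mem hcO) p) hyq (by norm_num)
    have herr : (c + (-c) ^ p) * y ^ p ^ (k + 1) + p * w ^ 2 * R +
        (c + y) * y ^ p ^ (k + 1) * (w ^ p + p * w + p * w ^ 2 * R) ∈ hv.ball s := by
      refine add_mem (add_mem ?_ (hv.ball_mono hsm hw2)) ?_
      · exact hv.mul_mem_ball_of_le (hv.add_neg_pow_mem_ball hp hvp hcO hcp) hyq (by linarith)
      · exact hv.mul_mem_ball_of_le hcyq
          (add_mem (add_mem hwp1 hpw) (hv.ball_mono (by linarith) hw2)) (by linarith)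
    refine ⟨1 + w, L.add_mem L.one_mem (L.neg_mem (L.mul_mem hcL (L.pow_mem hyL _))), _, herr, ?_⟩
    rw [hpow, hdk, hthc]
    linear_combination hwp + (p : F) * hw
  obtain ⟨u, hu, e, he, hfu⟩ :=
    hv.exists_mul_pow_prime_descend hp hvp hm0.le hs2 hsm L d hdL hd hdm hB hstart
  refine ⟨u, e, hu, Or.imp_right hs_lt.trans_le he, ?_⟩
  rw [hfu, hd0]
  ring

/-- with `h = y^(q²/p)/b_n − c` one has `v(h) = v(y)/p`,
`v(p·y^(q/p)·h) = 1 + (q²−1)/((p−1)q²) =: s`, and there are `u ∈ K(y)` and `r` with `v(r) > s`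
such that `f_{q,c}(y)·u^p = 1 + p·y^(q/p)·h + r`. -/
theorem stmt_12 (p n : ℕ) [Fact p.Prime] (hn : 1 ≤ n)
    (v : Omg p → ℚ)
    (hv_mul : ∀ x y : Omg p, x ≠ 0 → y ≠ 0 → v (x * y) = v x + v y)
    (hv_add : ∀ x y : Omg p, x ≠ 0 → y ≠ 0 → x + y ≠ 0 → min (v x) (v y) ≤ v (x + y))
    (hv_p : v ((p : ℕ) : Omg p) = 1)
    (hv_W : ∀ x : WittVector p (AlgebraicClosure (ZMod p)), x ≠ 0 →
      0 ≤ v (algebraMap (Kzero p) (Omg p)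
        (algebraMap (WittVector p (AlgebraicClosure (ZMod p))) (Kzero p) x)))
    (ζ : Omg p) (hζ : IsPrimitiveRoot ζ p)
    (μ : Omg p) (hμ : μ ^ (p ^ n + 1) = ζ - 1)
    (c : ↥(IntermediateField.adjoin (Kzero p) {μ}))
    (hc0 : (c : Omg p) ≠ 0) (hc_nonneg : 0 ≤ v (c : Omg p))
    (hcp : (c : Omg p) ^ p - (c : Omg p) = 0 ∨ 1 ≤ v ((c : Omg p) ^ p - (c : Omg p)))
    (hc_lt : v (c : Omg p) < (p : ℚ) / (((p : ℚ) ^ n + 1) * ((p : ℚ) - 1)))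
    (y : Omg p)
    (hy : Polynomial.aeval y (Lpoly ↥(IntermediateField.adjoin (Kzero p) {μ}) p n c) = 0)
    (h : Omg p) (hh : h = y ^ p ^ (2 * n - 1) / bCoef (Omg p) p n - (c : Omg p)) :
    v h = v y / (p : ℚ) ∧
    v ((p : Omg p) * y ^ p ^ (n - 1) * h) =
      1 + ((p : ℚ) ^ (2 * n) - 1) / (((p : ℚ) - 1) * (p : ℚ) ^ (2 * n)) ∧
    ∃ u r : Omg p,
      u ∈ IntermediateField.adjoin ↥(IntermediateField.adjoin (Kzero p) {μ}) {y} ∧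
      (r = 0 ∨ 1 + ((p : ℚ) ^ (2 * n) - 1) / (((p : ℚ) - 1) * (p : ℚ) ^ (2 * n)) < v r) ∧
      (fqc (Omg p) p n (c : Omg p)).eval y * u ^ p = 1 + (p : Omg p) * y ^ p ^ (n - 1) * h + r := by
  have hp : p.Prime := Fact.out
  have hp0 : (p : Omg p) ≠ 0 := by
    rw [← map_natCast (algebraMap (Kzero p) (Omg p))]
    exact (_root_.map_ne_zero _).mpr
      (WittVector.FractionRing.p_nonzero p (AlgebraicClosure (ZMod p)))
  have hv : IsRatVal v := ⟨hv_mul, hv_add⟩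
  have hvc : v (c : Omg p) = 0 := by
    by_contra hne
    have hpos : 0 < v (c : Omg p) := lt_of_le_of_ne hc_nonneg (Ne.symm hne)
    have hP2 : (2 : ℚ) ≤ p := by exact_mod_cast hp.two_le
    have hQP : (p : ℚ) ≤ (p : ℚ) ^ n := le_self_pow₀ (by linarith) (by omega)
    have hcp' : -(c : Omg p) ^ p ∈ hv.ball (p * v (c : Omg p)) :=
      neg_mem (hv.mem_ball_of_le (hv.map_pow hc0 p).ge)
    obtain ⟨h1, h2⟩ := hv.add_ne_zero_and_map_add_eq hc0 hcp' (by nlinarith)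
    have hneg : (c : Omg p) ^ p - c = -((c : Omg p) + -(c : Omg p) ^ p) := by ring
    rw [hneg, hv.map_neg, h2] at hcp
    have h1c := hcp.resolve_left (neg_ne_zero.mpr h1)
    have hpos' : 0 < ((p : ℚ) ^ n + 1) * ((p : ℚ) - 1) := mul_pos (by linarith) (by linarith)
    rw [lt_div_iff₀ hpos'] at hc_lt
    nlinarith
  have hy' : y ^ (p ^ n * p ^ n) = aCoef (Omg p) p n * ((c : Omg p) + y) *
      (1 + ((c : Omg p) + y) * y ^ p ^ n) ^ (p ^ n - 1) := by
    rw [← eval_fqc, ← sub_eq_zero, ← hy]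
    simp [Lpoly, aCoef, fqc]
  rw [eval_fqc]
  obtain ⟨h1, h2, u, r, hu, hr, hur⟩ := hv.fqc_mul_pow_prime hp hp0 hn hv_p
    (IntermediateField.adjoin ↥(IntermediateField.adjoin (Kzero p) {μ}) {y}).toSubfield
    (IntermediateField.algebraMap_mem _ c) (IntermediateField.mem_adjoin_simple_self _ y)
    hc0 hvc hcp hy' hh
  exact ⟨h1, h2, u, r, hu, hr, hur⟩
end
end

section
/- The extension K = K₀(μ) of K₀ is totally ramified of degree (p−1)(q+1); moreover, there exists an element π ∈ K with π^{(p−1)(q+1)} = p which is a uniformizer of K and satisfies K = K₀(π). -/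
open Polynomial

noncomputable section

instance (p : ℕ) [Fact p.Prime] (S : IntermediateField (Kzero p) (Omg p)) :
    Algebra (Kzero p) ↥S := S.algebra

set_option maxHeartbeats 2000000
set_option synthInstance.maxHeartbeats 1000000

/-- A finite free algebra over an `r`-adically complete ring is `r`-adically complete. -/
theorem isAdicComplete_span_algebraMap {R A : Type*} [CommRing R] [CommRing A] [Algebra R A]
    [Module.Free R A] [Module.Finite R A] (r : R) [IsAdicComplete (Ideal.span {r}) R] :
    IsAdicComplete (Ideal.span {algebraMap R A r}) A := by
  let b := Module.Free.chooseBasis R A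
  have key : ∀ (m : ℕ) (x y : A),
      x ≡ y [SMOD Ideal.span {algebraMap R A r} ^ m • (⊤ : Submodule A A)] ↔
        ∀ i, b.repr x i ≡ b.repr y i [SMOD Ideal.span {r} ^ m • (⊤ : Submodule R R)] := by
    intro m x y
    simp only [SModEq.sub_mem, smul_eq_mul, Ideal.mul_top, Ideal.span_singleton_pow,
      Ideal.mem_span_singleton]
    constructor
    · rintro ⟨z, hz⟩ i
      refine ⟨b.repr z i, ?_⟩
      rw [← map_pow, ← Algebra.smul_def] at hz
      simpa using DFunLike.congr_fun (congrArg b.repr hz) i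
    · intro h
      choose z hz using h
      refine ⟨∑ i, z i • b i, ?_⟩
      rw [← map_pow, ← Algebra.smul_def]
      apply b.repr.injective
      ext i
      rw [map_sub, map_smul, Finsupp.sub_apply, Finsupp.smul_apply, b.repr_sum_self, hz,
        smul_eq_mul]
  refine { haus' := fun x hx ↦ ?_, prec' := fun f hf ↦ ?_ }
  · apply b.repr.injective
    ext i
    rw [map_zero, Finsupp.zero_apply]
    exact IsHausdorff.haus' (I := Ideal.span {r}) _ fun m ↦ by
      simpa using (key m x 0).1 (hx m) i
  · have h : ∀ i, ∃ L, ∀ m, b.repr (f m) i ≡ L [SMOD Ideal.span {r} ^ m • (⊤ : Submodule R R)] :=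
      fun i ↦ IsPrecomplete.prec' (fun m ↦ b.repr (f m) i)
        fun {m k} hmk ↦ (key m _ _).1 (hf hmk) i
    choose L hL using h
    refine ⟨∑ i, L i • b i, fun m ↦ (key m _ _).2 fun i ↦ ?_⟩
    rw [b.repr_sum_self]
    exact hL i m

/-- Hensel's lemma for `d`-th roots with `d` prime to `p`: it suffices that the `p`-th power of
`u` is the inverse of a `d`-th power modulo `p`. -/
theorem exists_pow_eq_of_dvd_sub_one {A : Type*} [CommRing A] {p d : ℕ} (hp : p.Prime)
    (hdp : d.Coprime p) [HenselianRing A (Ideal.span {(p : A)})] {u c : A}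
    (h : (p : A) ∣ u ^ p * c ^ d - 1) : ∃ w : A, w ^ d = u := by
  obtain ⟨t, -, ht⟩ := Nat.exists_mul_mod_eq_one_of_coprime hdp hp.one_lt
  have ht' : d * t = 1 + p * (d * t / p) := by
    have := Nat.mod_add_div (d * t) p
    omega
  set s := d * t / p
  let I := Ideal.span {(p : A)}
  let φ := Ideal.Quotient.mk I
  have hφ : φ u ^ p * φ c ^ d = 1 := by
    rw [← Ideal.mem_span_singleton, ← Ideal.Quotient.eq_zero_iff_mem] at h
    simpa [sub_eq_zero] using h
  have hroot : φ (u ^ t * c ^ s) ^ d = φ u := by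
    calc φ (u ^ t * c ^ s) ^ d = φ u ^ (d * t) * (φ c ^ d) ^ s := by
          rw [map_mul, map_pow, map_pow, mul_pow]; ring
      _ = φ u * (φ u ^ p * φ c ^ d) ^ s := by rw [ht']; ring
      _ = φ u := by rw [hφ, one_pow, mul_one]
  have hd : d ≠ 0 := by
    rintro rfl
    exact hp.one_lt.ne' (by simpa using hdp)
  have hu : IsUnit (φ u) :=
    (isUnit_pow_iff hp.ne_zero).1 (IsUnit.of_mul_eq_one _ hφ)
  have hdu : IsUnit (φ (d : A)) := by
    refine IsUnit.of_mul_eq_one (φ (t : A)) ?_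
    have hp0 : φ (p : A) = 0 := Ideal.Quotient.eq_zero_iff_mem.2 (Ideal.mem_span_singleton_self _)
    rw [← map_mul, ← Nat.cast_mul, ht']
    push_cast
    rw [map_add, map_mul, hp0]
    simp
  obtain ⟨w, hw, -⟩ := HenselianRing.is_henselian (I := I) (X ^ d - C u)
    (monic_X_pow_sub_C u hd) (u ^ t * c ^ s)
    (by
      rw [← Ideal.Quotient.eq_zero_iff_mem]
      change φ _ = 0
      simp only [eval_sub, eval_pow, eval_X, eval_C, map_sub, map_pow φ _ d, hroot, sub_self])
    (by
      change IsUnit (φ _)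
      simp only [derivative_sub, derivative_X_pow, derivative_C, sub_zero, eval_mul, eval_pow,
        eval_X, eval_C, map_mul φ (d : A), map_pow φ _ (d - 1)]
      exact hdu.mul (((isUnit_pow_iff hd).1 (hroot ▸ hu)).pow _))
  exact ⟨w, by simpa [sub_eq_zero] using hw⟩

/-- If `ζ ^ p = 1`, then reduction modulo `ζ - 1` becomes reduction modulo `p` after taking
`p`-th powers. -/
theorem natCast_dvd_pow_sub_pow_of_sub_one_dvd {A : Type*} [CommRing A] {p : ℕ} (hp : p.Prime)
    {ζ x y : A} (hζ : ζ ^ p = 1) (h : ζ - 1 ∣ x - y) : (p : A) ∣ x ^ p - y ^ p := by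
  obtain ⟨r, hr⟩ := exists_add_pow_prime_eq hp (ζ - 1) 1
  obtain ⟨z, hz⟩ := h
  obtain ⟨s, hs⟩ := exists_add_pow_prime_eq hp y ((ζ - 1) * z)
  rw [← hz, add_sub_cancel, hz, mul_pow] at hs
  rw [sub_add_cancel, hζ] at hr
  refine ⟨y * ((ζ - 1) * z) * s - (ζ - 1) * r * z ^ p, ?_⟩
  linear_combination hs - z ^ p * hr

/-- The quotient of `p` by `(ζ - 1) ^ (p - 1)`, for a primitive `p`-th root of unity `ζ`. -/
def rootUnit {A : Type*} [CommRing A] (p : ℕ) (ζ : A) : A :=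
  ∏ k ∈ Finset.range (p - 1), -∑ j ∈ Finset.range (k + 1), ζ ^ j

theorem pow_mul_rootUnit {A : Type*} [CommRing A] [IsDomain A] {p : ℕ} (hp : p.Prime) {ζ : A}
    (hζ : IsPrimitiveRoot ζ p) : (ζ - 1) ^ (p - 1) * rootUnit p ζ = p := by
  have hp1 : p - 1 + 1 = p := Nat.sub_add_cancel hp.one_lt.le
  have h := IsPrimitiveRoot.prod_one_sub_pow_eq_order (n := p - 1) (hp1.symm ▸ hζ)
  rw [← Nat.cast_add_one, hp1] at h
  rw [← h, rootUnit]
  conv_lhs => rw [← Finset.card_range (p - 1)]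
  rw [← Finset.prod_const, Finset.card_range, ← Finset.prod_mul_distrib]
  refine Finset.prod_congr rfl fun k _ ↦ ?_
  rw [mul_neg, mul_comm, geom_sum_mul, neg_sub]

theorem sub_one_dvd_rootUnit_sub {A : Type*} [CommRing A] (p : ℕ) (ζ : A) :
    ζ - 1 ∣ rootUnit p ζ - rootUnit p 1 := by
  have h1 : Ideal.Quotient.mk (Ideal.span {ζ - 1}) ζ = 1 := by
    rw [← map_one (Ideal.Quotient.mk (Ideal.span {ζ - 1})), Ideal.Quotient.eq]
    exact Ideal.mem_span_singleton_self _
  rw [← Ideal.mem_span_singleton, ← Ideal.Quotient.eq]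
  simp [rootUnit, h1]

theorem map_rootUnit {A B : Type*} [CommRing A] [CommRing B] (f : A →+* B) (p : ℕ) (ζ : A) :
    f (rootUnit p ζ) = rootUnit p (f ζ) := by
  simp [rootUnit]

theorem rootUnit_one_ne_zero {k : Type*} [Field k] (p : ℕ) [CharP k p] :
    rootUnit p (1 : k) ≠ 0 := by
  simp only [rootUnit, one_pow, Finset.sum_const, Finset.card_range, nsmul_eq_mul, mul_one]
  refine Finset.prod_ne_zero_iff.2 fun i hi ↦ neg_ne_zero.2 fun h ↦ ?_
  rw [CharP.cast_eq_zero_iff _ p] at h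
  have := Nat.le_of_dvd i.succ_pos h
  have := Finset.mem_range.1 hi
  omega

theorem WittVector.exists_dvd_mul_pow_sub_one {p d : ℕ} [Fact p.Prime] {k : Type*} [Field k]
    [IsAlgClosed k] [CharP k p] (hd : d ≠ 0) (a : WittVector p k)
    (ha : WittVector.constantCoeff a ≠ 0) :
    ∃ c : WittVector p k, (p : WittVector p k) ∣ a * c ^ d - 1 := by
  obtain ⟨z, hz⟩ := IsAlgClosed.exists_pow_nat_eq (WittVector.constantCoeff a)⁻¹
    (Nat.pos_of_ne_zero hd)
  obtain ⟨c, rfl⟩ := WittVector.constantCoeff_surjective p z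
  refine ⟨c, ?_⟩
  rw [← Ideal.mem_span_singleton, ← WittVector.ker_constantCoeff, RingHom.mem_ker]
  rw [map_sub, map_mul, map_pow, hz, map_one, mul_inv_cancel₀ ha, sub_self]

theorem exists_pow_eq_rootUnit {p d : ℕ} [Fact p.Prime] (hd : d.Coprime p)
    {ζ : Omg p} (hζ : IsPrimitiveRoot ζ p) :
    ∃ w ∈ Algebra.adjoin (WittVector p (AlgebraicClosure (ZMod p))) {ζ},
      w ^ d = rootUnit p ζ := by
  have hp : p.Prime := Fact.out
  have hd0 : d ≠ 0 := by
    rintro rfl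
    exact hp.one_lt.ne' (by simpa using hd)
  let W := WittVector p (AlgebraicClosure (ZMod p))
  let A := Algebra.adjoin W {ζ}
  have hint : IsIntegral W ζ :=
    ⟨X ^ p - 1, monic_X_pow_sub_C 1 hp.ne_zero, by simp [hζ.pow_eq_one]⟩
  have : Module.Finite W A := Algebra.finite_adjoin_simple_of_isIntegral hint
  have : FaithfulSMul W (Omg p) := (faithfulSMul_iff_algebraMap_injective _ _).2 <| by
    rw [IsScalarTower.algebraMap_eq W (Kzero p) (Omg p)]
    exact (algebraMap (Kzero p) (Omg p)).injective.comp (IsFractionRing.injective W (Kzero p))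
  have hpA : algebraMap W A (p : W) = (p : A) := map_natCast (algebraMap W A) p
  have : IsAdicComplete (Ideal.span {(p : A)}) A := by
    rw [← hpA]
    exact isAdicComplete_span_algebraMap (A := A) (p : W)
  let ζA : A := ⟨ζ, Algebra.self_mem_adjoin_singleton W ζ⟩
  have hζA : ζA ^ p = 1 := Subtype.ext (by simpa [ζA] using hζ.pow_eq_one)
  obtain ⟨c, hc⟩ := WittVector.exists_dvd_mul_pow_sub_one hd0 (rootUnit p (1 : W) ^ p) (by
    rw [map_pow, map_rootUnit, map_one]
    exact pow_ne_zero _ (rootUnit_one_ne_zero p))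
  obtain ⟨w, hw⟩ := exists_pow_eq_of_dvd_sub_one hp hd (u := rootUnit p ζA)
    (c := algebraMap W A c) (by
      have h1 := natCast_dvd_pow_sub_pow_of_sub_one_dvd hp hζA (sub_one_dvd_rootUnit_sub p ζA)
      have h2 := map_dvd (algebraMap W A) hc
      simp only [map_sub, map_mul, map_pow, map_rootUnit, map_one, hpA] at h2
      convert dvd_add (h1.mul_right (algebraMap W A c ^ d)) h2 using 1
      ring)
  refine ⟨w, w.2, ?_⟩
  rw [← SubmonoidClass.coe_pow, hw]
  exact map_rootUnit A.val.toRingHom p ζA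

theorem natCast_ne_zero_witt (p : ℕ) [Fact p.Prime] :
    (p : WittVector p (AlgebraicClosure (ZMod p))) ≠ 0 :=
  (WittVector.irreducible p).ne_zero

theorem natCast_ne_zero_omg (p : ℕ) [Fact p.Prime] : (p : Omg p) ≠ 0 := by
  rw [← map_natCast (algebraMap (Kzero p) (Omg p)),
    ← map_natCast (algebraMap (WittVector p (AlgebraicClosure (ZMod p))) (Kzero p))]
  simpa only [ne_eq, FaithfulSMul.algebraMap_eq_zero_iff] using natCast_ne_zero_witt p

theorem irreducible_X_pow_sub_natCast {p d : ℕ} [Fact p.Prime] (hd : d ≠ 0) :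
    Irreducible (X ^ d - C (p : Kzero p)) := by
  let W := WittVector p (AlgebraicClosure (ZMod p))
  have hmon : (X ^ d - C (p : W)).Monic := monic_X_pow_sub_C _ hd
  have hdeg : (X ^ d - C (p : W)).natDegree = d := natDegree_X_pow_sub_C
  have hprime : Prime (p : W) := (WittVector.irreducible p).prime
  have heis : (X ^ d - C (p : W)).IsEisensteinAt (Ideal.span {(p : W)}) := by
    refine ⟨?_, fun {k} hk ↦ ?_, ?_⟩
    · rw [hmon.leadingCoeff, Ideal.mem_span_singleton]
      exact fun h ↦ hprime.not_isUnit (isUnit_of_dvd_one h)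
    · rw [hdeg] at hk
      rw [coeff_sub, coeff_X_pow, if_neg hk.ne, coeff_C, zero_sub, neg_mem_iff]
      split_ifs
      · exact Ideal.mem_span_singleton_self _
      · exact zero_mem _
    · rw [coeff_sub, coeff_X_pow, if_neg hd.symm, coeff_C_zero, zero_sub, neg_mem_iff,
        Ideal.span_singleton_pow, Ideal.mem_span_singleton, pow_two]
      intro h
      exact hprime.not_isUnit (isUnit_of_dvd_one
        ((mul_dvd_mul_iff_left hprime.ne_zero).1 (by simpa using h)))
  have hirr := heis.irreducible ((Ideal.span_singleton_prime hprime.ne_zero).2 hprime)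
    hmon.isPrimitive (by rw [hdeg]; exact Nat.pos_of_ne_zero hd)
  have hmap : (X ^ d - C (p : W)).map (algebraMap W (Kzero p)) = X ^ d - C (p : Kzero p) := by
    rw [Polynomial.map_sub, Polynomial.map_pow, map_X, map_C,
      show algebraMap W (Kzero p) (p : W) = (p : Kzero p) from map_natCast _ p]
  exact hmap ▸ (hmon.irreducible_iff_irreducible_map_fraction_map (K := Kzero p)).1 hirr

theorem map_pow_of_map_mul {F : Type*} [Field F] {v : F → ℚ}
    (hv : ∀ x y : F, x ≠ 0 → y ≠ 0 → v (x * y) = v x + v y) {x : F} (hx : x ≠ 0) (m : ℕ) :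
    v (x ^ m) = m * v x := by
  induction m with
  | zero =>
    have := hv 1 1 one_ne_zero one_ne_zero
    rw [mul_one] at this
    simpa using this
  | succ m ih =>
    rw [pow_succ, hv _ _ (pow_ne_zero m hx) hx, ih]
    push_cast
    ring

theorem finrank_adjoin_le_of_pow_eq_sub_one {F E : Type*} [Field F] [Field E] [Algebra F E]
    {p m : ℕ} (hp : p.Prime) (hm : m ≠ 0) {ζ μ : E} (hζ : IsPrimitiveRoot ζ p)
    (hμ : μ ^ m = ζ - 1) :
    FiniteDimensional F (IntermediateField.adjoin F {μ}) ∧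
      Module.finrank F (IntermediateField.adjoin F {μ}) ≤ (p - 1) * m := by
  let f : F[X] := (cyclotomic p F).comp (X ^ m + C 1)
  have hdeg : f.natDegree = (p - 1) * m := by
    rw [natDegree_comp, natDegree_cyclotomic, Nat.totient_prime hp, natDegree_X_pow_add_C]
  have hmonic : f.Monic := (cyclotomic.monic p F).comp (monic_X_pow_add_C 1 hm) (by
    rwa [natDegree_X_pow_add_C])
  have hroot : aeval μ f = 0 := by
    have := hζ.isRoot_cyclotomic hp.pos
    have hx : aeval μ (X ^ m + C (1 : F)) = ζ := by simp [hμ]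
    rw [aeval_comp, hx, aeval_def, ← eval_map, map_cyclotomic]
    exact this
  have hint : IsIntegral F μ := ⟨f, hmonic, hroot⟩
  refine ⟨IntermediateField.adjoin.finiteDimensional hint, ?_⟩
  rw [IntermediateField.adjoin.finrank hint, ← hdeg]
  exact natDegree_le_of_dvd (minpoly.dvd F μ hroot) hmonic.ne_zero

/-- `K = K₀(μ)` is totally ramified of degree `(p−1)(q+1)` over `K₀`, and there is
a uniformizer `π` of `K` with `π^((p−1)(q+1)) = p` and `K = K₀(π)`. -/
theorem stmt_14 (p n : ℕ) [Fact p.Prime] (hn : 1 ≤ n)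
    (v : Omg p → ℚ)
    (hv_mul : ∀ x y : Omg p, x ≠ 0 → y ≠ 0 → v (x * y) = v x + v y)
    (hv_add : ∀ x y : Omg p, x ≠ 0 → y ≠ 0 → x + y ≠ 0 → min (v x) (v y) ≤ v (x + y))
    (hv_p : v ((p : ℕ) : Omg p) = 1)
    (hv_W : ∀ x : WittVector p (AlgebraicClosure (ZMod p)), x ≠ 0 →
      0 ≤ v (algebraMap (Kzero p) (Omg p)
        (algebraMap (WittVector p (AlgebraicClosure (ZMod p))) (Kzero p) x)))
    (ζ : Omg p) (hζ : IsPrimitiveRoot ζ p)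
    (μ : Omg p) (hμ : μ ^ (p ^ n + 1) = ζ - 1) :
    Module.finrank (Kzero p) ↥(IntermediateField.adjoin (Kzero p) {μ}) =
      (p - 1) * (p ^ n + 1) ∧
    ∃ π : Omg p, π ∈ IntermediateField.adjoin (Kzero p) {μ} ∧
      π ^ ((p - 1) * (p ^ n + 1)) = (p : Omg p) ∧
      v π = 1 / (((p : ℚ) - 1) * ((p : ℚ) ^ n + 1)) ∧
      IntermediateField.adjoin (Kzero p) {π} = IntermediateField.adjoin (Kzero p) {μ} := by
  have hp : p.Prime := Fact.out
  have hm : p ^ n + 1 ≠ 0 := Nat.succ_ne_zero _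
  set d := (p - 1) * (p ^ n + 1) with hd_def
  have hd : d ≠ 0 := mul_ne_zero (Nat.sub_ne_zero_of_lt hp.one_lt) hm
  have hdp : d.Coprime p := by
    refine Nat.Coprime.mul_left ?_ ?_
    · refine (Nat.coprime_of_lt_prime ?_ ?_ hp).symm <;>
      have := hp.one_lt <;> omega
    · refine ((Nat.Prime.coprime_iff_not_dvd hp).2 fun h ↦ hp.one_lt.ne' ?_).symm
      exact Nat.dvd_one.1 ((Nat.dvd_add_right (dvd_pow_self p (by omega))).1 h)
  obtain ⟨w, hwA, hw⟩ := exists_pow_eq_rootUnit hdp hζ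
  have hζμ : ζ ∈ IntermediateField.adjoin (Kzero p) {μ} := by
    rw [← sub_add_cancel ζ 1, ← hμ]
    exact add_mem (pow_mem (IntermediateField.mem_adjoin_simple_self _ μ) _) (one_mem _)
  have hwK : w ∈ IntermediateField.adjoin (Kzero p) {μ} := by
    let W := WittVector p (AlgebraicClosure (ZMod p))
    have hle : Algebra.adjoin W {ζ} ≤
        (IntermediateField.adjoin (Kzero p) {μ}).toSubalgebra.restrictScalars W :=
      Algebra.adjoin_le (Set.singleton_subset_iff.2 hζμ)
    exact hle hwA
  have hπ : (μ * w) ^ d = (p : Omg p) := by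
    rw [mul_pow, hw, hd_def, mul_comm (p - 1), pow_mul, hμ, pow_mul_rootUnit hp hζ]
  have hπK : μ * w ∈ IntermediateField.adjoin (Kzero p) {μ} :=
    mul_mem (IntermediateField.mem_adjoin_simple_self _ μ) hwK
  have hπ0 : μ * w ≠ 0 := by
    intro h
    rw [h, zero_pow hd] at hπ
    exact natCast_ne_zero_omg p hπ.symm
  obtain ⟨hfin, hle⟩ := finrank_adjoin_le_of_pow_eq_sub_one (F := Kzero p) hp hm hζ hμ
  have hrank : Module.finrank (Kzero p) (IntermediateField.adjoin (Kzero p) {μ * w}) = d := by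
    have hmin : X ^ d - C (p : Kzero p) = minpoly (Kzero p) (μ * w) :=
      minpoly.eq_of_irreducible_of_monic (irreducible_X_pow_sub_natCast hd) (by simp [hπ])
        (monic_X_pow_sub_C _ hd)
    rw [IntermediateField.adjoin.finrank (Algebra.IsIntegral.isIntegral _), ← hmin,
      natDegree_X_pow_sub_C]
  have heq : IntermediateField.adjoin (Kzero p) {μ * w} =
      IntermediateField.adjoin (Kzero p) {μ} :=
    IntermediateField.eq_of_le_of_finrank_le
      (IntermediateField.adjoin_simple_le_iff.2 hπK) (hrank.symm ▸ hle)
  refine ⟨heq ▸ hrank, μ * w, hπK, hπ, ?_, heq⟩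
  have hvπ := map_pow_of_map_mul hv_mul hπ0 d
  rw [hπ, hv_p, hd_def, Nat.cast_mul, Nat.cast_sub hp.one_lt.le] at hvπ
  push_cast at hvπ
  exact eq_one_div_of_mul_eq_one_right hvπ.symm
end
end
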